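/- arXiv:2506.02640 — 2 statements merged into one kernel-verified Lean document; each statement's English description precedes it below -/
import Mathlib

section
/- (Falconer; Kombrink–Winter) Let N ≥ 2 and let S₁, …, S_N : ℝ → ℝ be contracting similarities with scaling ratios r₁, …, r_N ∈ (0,1), satisfying the open set condition: there exists a nonempty bounded open set O ⊆ ℝ such that the images S₁(O), …, S_N(O) are pairwise disjoint and contained in O. Let F be the attractor, i.e. the unique nonempty compact set with F = S₁(F) ∪ … ∪ S_N(F), and let D be the unique real number with r₁^D + … + r_N^D = 1; assume D < 1. Assume the system is lattice: there exists a > 0 such that log r_i ∈ a·ℤ for all i. Then F is not Minkowski measurable: the limit lim_{ε→0⁺} λ¹(F_ε)/ε^(1−D) does not exist as a number in (0, ∞). -/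
open MeasureTheory Metric Set Real Filter Topology

namespace LatticeSelfSimilar

/-! ### Similarities of the line -/

lemma exists_affine_of_dist {f : ℝ → ℝ} {r : ℝ}
    (hf : ∀ x y, dist (f x) (f y) = r * dist x y) :
    ∃ c d : ℝ, |c| = r ∧ ∀ x, f x = c * x + d := by
  refine ⟨f 1 - f 0, f 0, ?_, fun x => ?_⟩
  · simpa [Real.dist_eq] using hf 1 0
  · have sq : ∀ x y, (f x - f y) ^ 2 = r ^ 2 * (x - y) ^ 2 := fun x y => by
      rw [← sq_abs (f x - f y), ← sq_abs (x - y), ← Real.dist_eq, ← Real.dist_eq, hf, mul_pow]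
    have h1 := sq x 0
    have h2 := sq 1 0
    have h3 := sq x 1
    have h4 : (f x - ((f 1 - f 0) * x + f 0)) ^ 2 = 0 := by
      have : (f x - f 0) * (f 1 - f 0) = r ^ 2 * x := by nlinarith
      linear_combination h1 + x ^ 2 * h2 - 2 * x * this
    linarith [pow_eq_zero_iff (two_ne_zero) |>.1 h4]

open scoped Pointwise in
lemma volume_image_similarity {f : ℝ → ℝ} {r : ℝ}
    (hf : ∀ x y, dist (f x) (f y) = r * dist x y) (s : Set ℝ) :
    volume (f '' s) = ENNReal.ofReal r * volume s := by
  obtain ⟨c, d, hc, hcd⟩ := exists_affine_of_dist hf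
  have : f '' s = (fun x => x + d) '' (c • s) := by
    rw [← image_smul, image_image]
    exact image_congr fun x _ => by simp [hcd]
  rw [this, image_add_right, measure_preimage_add_right, Measure.addHaar_smul]
  simp [hc]

lemma injective_similarity {f : ℝ → ℝ} {r : ℝ} (hr : 0 < r)
    (hf : ∀ x y, dist (f x) (f y) = r * dist x y) : Function.Injective f := by
  intro x y hxy
  have := hf x y
  rw [hxy, dist_self] at this
  exact dist_eq_zero.1 ((mul_eq_zero.1 this.symm).resolve_left hr.ne')

/-! ### Gaps and the second difference of the parallel volume -/

/-- The open ball `ball m ρ` is a bounded component of the complement of the closed set `F`. -/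
def IsGap (F : Set ℝ) (m ρ : ℝ) : Prop :=
  m - ρ ∈ F ∧ m + ρ ∈ F ∧ ∀ x ∈ F, ρ ≤ dist x m

lemma exists_isGap {F : Set ℝ} (hF : IsCompact F) {p q : ℝ} (hp : p ∈ F) (hq : q ∈ F)
    (hpq : p < q) (hvol : volume F = 0) :
    ∃ m ρ, 0 < ρ ∧ p ≤ m - ρ ∧ m + ρ ≤ q ∧ IsGap F m ρ := by
  obtain ⟨z, hz, hzF⟩ : ∃ z ∈ Icc p q, z ∉ F := by
    by_contra! h
    have := measure_mono_null (μ := volume) (show Icc p q ⊆ F from h) hvol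
    rw [Real.volume_Icc, ENNReal.ofReal_eq_zero] at this
    linarith
  obtain ⟨a, ⟨haF, haz⟩, ha⟩ := (hF.inter_right (isClosed_Iic (a := z))).exists_isGreatest
    ⟨p, hp, hz.1⟩
  obtain ⟨b, ⟨hbF, hbz⟩, hb⟩ := (hF.inter_right (isClosed_Ici (a := z))).exists_isLeast
    ⟨q, hq, hz.2⟩
  have haz' : a < z := lt_of_le_of_ne haz fun h => hzF (h ▸ haF)
  have hbz' : z < b := lt_of_le_of_ne hbz fun h => hzF (h ▸ hbF)
  have hpa : p ≤ a := ha ⟨hp, hz.1⟩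
  have hbq : b ≤ q := hb ⟨hq, hz.2⟩
  refine ⟨(a + b) / 2, (b - a) / 2, by linarith, by linarith, by linarith, ?_, ?_, fun x hx => ?_⟩
  · convert haF using 1; ring
  · convert hbF using 1; ring
  · rw [Real.dist_eq]
    rcases le_total x z with h | h
    · have : x ≤ a := ha ⟨hx, h⟩
      rw [abs_of_nonpos] <;> linarith
    · have : b ≤ x := hb ⟨hx, h⟩
      rw [abs_of_nonneg] <;> linarith

lemma mem_or_mem_of_infDist {F : Set ℝ} (hF : IsCompact F) (hne : F.Nonempty) (x : ℝ) :
    x - infDist x F ∈ F ∨ x + infDist x F ∈ F := by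
  obtain ⟨y, hy, hxy⟩ := hF.exists_infDist_eq_dist hne x
  rw [hxy, Real.dist_eq]
  rcases abs_cases (x - y) with ⟨h, -⟩ | ⟨h, -⟩ <;> rw [h]
  · left; simpa using hy
  · right; simpa using hy

lemma mem_cthickening_iff {F : Set ℝ} (hne : F.Nonempty) {ε x : ℝ} (hε : 0 ≤ ε) :
    x ∈ cthickening ε F ↔ infDist x F ≤ ε := by
  rw [cthickening, mem_ofPred_eq, infDist]
  exact ENNReal.le_ofReal_iff_toReal_le (infEDist_ne_top hne) hε

/-- The parallel volume has a nonnegative concavity defect, to which each gap of diameter `2 * ε`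
contributes `2 * h`. -/
lemma volume_cthickening_second_difference {F : Set ℝ} (hF : IsCompact F) (hne : F.Nonempty)
    {ι : Type*} (t : Finset ι) (m : ι → ℝ) {ε h : ℝ} (hh : 0 < h) (hhε : h < ε)
    (hgap : ∀ j ∈ t, IsGap F (m j) ε)
    (hdisj : ∀ i ∈ t, ∀ j ∈ t, i ≠ j → Disjoint (ball (m i) h) (ball (m j) h)) :
    (volume (cthickening (ε - h) F)).toReal + (volume (cthickening (ε + h) F)).toReal
      + 2 * h * t.card ≤ 2 * (volume (cthickening ε F)).toReal := by
  have hε : 0 < ε := hh.trans hhε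
  set V : ℝ → Set ℝ := fun δ => cthickening δ F
  have hmem : ∀ {δ x}, 0 ≤ δ → (x ∈ V δ ↔ infDist x F ≤ δ) := fun hδ =>
    mem_cthickening_iff hne hδ
  have hfin : ∀ δ, volume (V δ) ≠ ⊤ := fun δ => (hF.cthickening.measure_lt_top).ne
  have hcont : Continuous fun x => infDist x F := continuous_infDist_pt F
  have hge : ∀ {x y}, y ∈ F → infDist x F ≤ |x - y| := fun hy => infDist_le_dist_of_mem hy
  set A : Set ℝ := {x | (ε < infDist x F ∧ infDist x F ≤ ε + h) ∧ x - infDist x F ∈ F}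
  set B : Set ℝ := {x | (ε < infDist x F ∧ infDist x F ≤ ε + h) ∧ x + infDist x F ∈ F}
  have hAB : V (ε + h) ⊆ V ε ∪ (A ∪ B) := by
    intro x hx
    rw [hmem (by linarith)] at hx
    by_cases hx' : infDist x F ≤ ε
    · exact Or.inl ((hmem hε.le).2 hx')
    · rcases mem_or_mem_of_infDist hF hne x with h1 | h1
      · exact Or.inr (Or.inl ⟨⟨not_le.1 hx', hx⟩, h1⟩)
      · exact Or.inr (Or.inr ⟨⟨not_le.1 hx', hx⟩, h1⟩)
  have hrange : MeasurableSet {x | ε < infDist x F ∧ infDist x F ≤ ε + h} :=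
    (measurableSet_lt measurable_const hcont.measurable).inter
      (measurableSet_le hcont.measurable measurable_const)
  have hAm : MeasurableSet A := hrange.inter
    (hF.isClosed.preimage (continuous_id.sub hcont)).measurableSet
  have hBm : MeasurableSet B := hrange.inter
    (hF.isClosed.preimage (continuous_id.add hcont)).measurableSet
  -- `A` and `B` shifted towards `F` by `h`
  set A' : Set ℝ := (fun x => x + h) ⁻¹' A
  set B' : Set ℝ := (fun x => x + (-h)) ⁻¹' B
  have hA'm : MeasurableSet A' := hAm.preimage (measurable_id.add_const _)
  have hB'm : MeasurableSet B' := hBm.preimage (measurable_id.add_const _)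
  have volA' : volume A' = volume A := measure_preimage_add_right _ _ _
  have volB' : volume B' = volume B := measure_preimage_add_right _ _ _
  -- points of `A'` sit in the left half of a gap of diameter larger than `2 * ε`
  have keyA : ∀ z ∈ A', ∃ y ∈ F, ∃ δ, ε < δ ∧ δ ≤ ε + h ∧ z = y + δ - h ∧
      ∀ x ∈ F, δ ≤ |y + δ - x| := by
    rintro z ⟨⟨h1, h2⟩, h3⟩
    exact ⟨_, h3, infDist (z + h) F, h1, h2, by ring, fun x hx => by
      simpa using hge (x := z + h) hx⟩
  have keyB : ∀ z ∈ B', ∃ y ∈ F, ∃ δ, ε < δ ∧ δ ≤ ε + h ∧ z = y - δ + h ∧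
      ∀ x ∈ F, δ ≤ |y - δ - x| := by
    rintro z ⟨⟨h1, h2⟩, h3⟩
    exact ⟨_, h3, infDist (z + -h) F, h1, h2, by ring, fun x hx => by
      simpa using hge (x := z + -h) hx⟩
  have infA : ∀ z ∈ A', ε - h < infDist z F ∧ infDist z F ≤ ε := by
    intro z hz
    have h0 : infDist (z + h) F ≤ infDist z F + h := by
      simpa [Real.dist_eq, abs_of_pos hh] using
        infDist_le_infDist_add_dist (s := F) (x := z + h) (y := z)
    obtain ⟨⟨h1, -⟩, -⟩ := id hz
    obtain ⟨y, hy, δ, h3, h4, rfl, -⟩ := keyA z hz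
    refine ⟨by linarith, (hge hy).trans ?_⟩
    rw [abs_le]; constructor <;> linarith
  have infB : ∀ z ∈ B', ε - h < infDist z F ∧ infDist z F ≤ ε := by
    intro z hz
    have h0 : infDist (z + -h) F ≤ infDist z F + h := by
      simpa [Real.dist_eq, abs_of_pos hh] using
        infDist_le_infDist_add_dist (s := F) (x := z + -h) (y := z)
    obtain ⟨⟨h1, -⟩, -⟩ := id hz
    obtain ⟨y, hy, δ, h3, h4, rfl, -⟩ := keyB z hz
    refine ⟨by linarith, (hge hy).trans ?_⟩
    rw [abs_le]; constructor <;> linarith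
  set M : Set ℝ := ⋃ j ∈ t, ball (m j) h with hM
  have infM : ∀ z ∈ M, ε - h < infDist z F ∧ infDist z F ≤ ε := by
    intro z hz
    simp only [hM, mem_iUnion, mem_ball, Real.dist_eq, exists_prop] at hz
    obtain ⟨j, hj, hz⟩ := hz
    obtain ⟨g1, g2, g3⟩ := hgap j hj
    rw [abs_lt] at hz
    constructor
    · obtain ⟨y, hy, hxy⟩ := hF.exists_infDist_eq_dist hne z
      rw [hxy]
      have h5 := g3 y hy
      rw [Real.dist_eq] at *
      rcases abs_cases (y - m j) with ⟨h6, -⟩ | ⟨h6, -⟩ <;>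
      rcases abs_cases (z - y) with ⟨h7, h8⟩ | ⟨h7, h8⟩ <;> linarith
    · rcases le_total z (m j) with h6 | h6
      · refine (hge g1).trans ?_
        rw [abs_le]; constructor <;> linarith
      · refine (hge g2).trans ?_
        rw [abs_le]; constructor <;> linarith
  have dAB : Disjoint A' B' := by
    rw [Set.disjoint_left]
    intro z hz hz'
    obtain ⟨y, hy, δ, h3, h4, rfl, h5⟩ := keyA z hz
    obtain ⟨y', hy', δ', h3', h4', h6, h5'⟩ := keyB _ hz'
    have a1 := h5 y' hy'
    have a2 : y' - (y + δ) = δ' - 2 * h := by linarith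
    rcases abs_cases (y + δ - y') with ⟨h8, -⟩ | ⟨h8, -⟩
    · linarith
    have a3 := h5' y hy
    rcases abs_cases (y' - δ' - y) with ⟨h9, -⟩ | ⟨h9, -⟩ <;> linarith
  have dAM : Disjoint (A' ∪ B') M := by
    rw [Set.disjoint_left]
    intro z hz hzM
    simp only [hM, mem_iUnion, mem_ball, Real.dist_eq, exists_prop] at hzM
    obtain ⟨j, hj, hzj⟩ := hzM
    obtain ⟨g1, g2, g3⟩ := hgap j hj
    rw [abs_lt] at hzj
    rcases hz with hz | hz
    · obtain ⟨y, hy, δ, h3, h4, rfl, h5⟩ := keyA z hz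
      have a1 := h5 _ g1
      have a2 := h5 _ g2
      have a3 := g3 y hy
      rw [Real.dist_eq] at a3
      rcases abs_cases (y + δ - (m j - ε)) with ⟨b1, -⟩ | ⟨b1, -⟩ <;>
      rcases abs_cases (y + δ - (m j + ε)) with ⟨b2, -⟩ | ⟨b2, -⟩ <;>
      rcases abs_cases (y - m j) with ⟨b3, -⟩ | ⟨b3, -⟩ <;> linarith
    · obtain ⟨y, hy, δ, h3, h4, rfl, h5⟩ := keyB z hz
      have a1 := h5 _ g1
      have a2 := h5 _ g2
      have a3 := g3 y hy
      rw [Real.dist_eq] at a3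
      rcases abs_cases (y - δ - (m j - ε)) with ⟨b1, -⟩ | ⟨b1, -⟩ <;>
      rcases abs_cases (y - δ - (m j + ε)) with ⟨b2, -⟩ | ⟨b2, -⟩ <;>
      rcases abs_cases (y - m j) with ⟨b3, -⟩ | ⟨b3, -⟩ <;> linarith
  have hMm : MeasurableSet M := Finset.measurableSet_biUnion _ fun _ _ => measurableSet_ball
  have volM : volume M = ENNReal.ofReal (2 * h * t.card) := by
    rw [hM, measure_biUnion_finset (fun i hi j hj hij => hdisj i hi j hj hij)
      fun _ _ => measurableSet_ball]
    simp only [Real.volume_ball, Finset.sum_const, nsmul_eq_mul]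
    rw [mul_comm, ENNReal.ofReal_mul (p := 2 * h) (by positivity), ENNReal.ofReal_natCast]
  have hsub : V (ε - h) ∪ (A' ∪ B' ∪ M) ⊆ V ε := by
    have : ∀ z ∈ A' ∪ B' ∪ M, z ∈ V ε := by
      rintro z ((hz | hz) | hz)
      exacts [(hmem hε.le).2 (infA z hz).2, (hmem hε.le).2 (infB z hz).2,
        (hmem hε.le).2 (infM z hz).2]
    exact union_subset (cthickening_mono (by linarith) F) this
  have dV : Disjoint (V (ε - h)) (A' ∪ B' ∪ M) := by
    rw [Set.disjoint_left]
    intro z hzV hz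
    rw [hmem (by linarith)] at hzV
    rcases hz with (hz | hz) | hz
    exacts [absurd hzV (infA z hz).1.not_ge, absurd hzV (infB z hz).1.not_ge,
      absurd hzV (infM z hz).1.not_ge]
  have low : volume (V (ε - h)) + (volume A + volume B + ENNReal.ofReal (2 * h * t.card))
      ≤ volume (V ε) := by
    rw [← volA', ← volB', ← volM, ← measure_union dAB hB'm, ← measure_union dAM hMm,
      ← measure_union dV ((hA'm.union hB'm).union hMm)]
    exact measure_mono hsub
  have up : volume (V (ε + h)) ≤ volume (V ε) + (volume A + volume B) :=
    (measure_mono hAB).trans ((measure_union_le _ _).trans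
      (add_le_add le_rfl (measure_union_le _ _)))
  have total : volume (V (ε - h)) + volume (V (ε + h)) + ENNReal.ofReal (2 * h * t.card)
      ≤ 2 * volume (V ε) := by
    calc _ ≤ volume (V (ε - h)) + (volume (V ε) + (volume A + volume B))
          + ENNReal.ofReal (2 * h * t.card) := by gcongr
      _ = volume (V ε) + (volume (V (ε - h)) + (volume A + volume B
          + ENNReal.ofReal (2 * h * t.card))) := by ring
      _ ≤ volume (V ε) + volume (V ε) := by gcongr
      _ = _ := (two_mul _).symm
  have := ENNReal.toReal_mono (ENNReal.mul_ne_top (by simp) (hfin ε)) total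
  rwa [ENNReal.toReal_add (ENNReal.add_ne_top.2 ⟨hfin _, hfin _⟩) ENNReal.ofReal_ne_top,
    ENNReal.toReal_add (hfin _) (hfin _), ENNReal.toReal_ofReal (by positivity),
    ENNReal.toReal_mul, ENNReal.toReal_ofNat] at this

/-- A function with a uniformly large concavity defect at arbitrarily small scales is not
asymptotic to a power. -/
lemma not_tendsto_div_rpow {V : ℝ → ℝ} {s c L : ℝ} (hc : 0 < c)
    (hV : ∃ᶠ ε in 𝓝[>] (0 : ℝ), ∀ η ∈ Ioo (0 : ℝ) 1,
      V ((1 - η) * ε) + V ((1 + η) * ε) + c * η * ε ^ s ≤ 2 * V ε) :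
    ¬ Tendsto (fun ε => V ε / ε ^ s) (𝓝[>] 0) (𝓝 L) := by
  intro hL
  have scale : ∀ b : ℝ, 0 < b →
      Tendsto (fun ε => V (b * ε) / ε ^ s) (𝓝[>] 0) (𝓝 (b ^ s * L)) := by
    intro b hb
    have h1 : Tendsto (fun ε : ℝ => b * ε) (𝓝[>] 0) (𝓝[>] 0) := by
      refine tendsto_nhdsWithin_iff.2 ⟨?_, ?_⟩
      · have : Tendsto (fun ε : ℝ => b * ε) (𝓝 0) (𝓝 (b * 0)) := tendsto_id.const_mul b
        rw [mul_zero] at this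
        exact this.mono_left nhdsWithin_le_nhds
      · filter_upwards [self_mem_nhdsWithin] with ε hε
        exact mul_pos hb hε
    refine ((hL.comp h1).const_mul (b ^ s)).congr' ?_
    filter_upwards [self_mem_nhdsWithin] with ε hε
    have hb' := (Real.rpow_pos_of_pos hb s).ne'
    have hε' := (Real.rpow_pos_of_pos hε s).ne'
    change b ^ s * (V (b * ε) / (b * ε) ^ s) = _
    rw [Real.mul_rpow hb.le (le_of_lt hε)]
    field_simp
  have ineq : ∀ η ∈ Ioo (0 : ℝ) 1, (1 - η) ^ s * L + (1 + η) ^ s * L + c * η ≤ 2 * L := by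
    intro η hη
    have h1 := (((scale (1 - η) (by linarith [hη.2])).add
      (scale (1 + η) (by linarith [hη.1]))).add_const (c * η)).sub (hL.const_mul 2)
    have h2 : ∃ᶠ ε in 𝓝[>] (0 : ℝ), V ((1 - η) * ε) / ε ^ s + V ((1 + η) * ε) / ε ^ s + c * η
        - 2 * (V ε / ε ^ s) ∈ Iic (0 : ℝ) := by
      refine (hV.and_eventually self_mem_nhdsWithin).mono fun ε hε => ?_
      have hp := Real.rpow_pos_of_pos (show 0 < ε from hε.2) s
      have h3 := hε.1 η hη
      have : V ((1 - η) * ε) / ε ^ s + V ((1 + η) * ε) / ε ^ s + c * η - 2 * (V ε / ε ^ s)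
          = (V ((1 - η) * ε) + V ((1 + η) * ε) + c * η * ε ^ s - 2 * V ε) / ε ^ s := by
        field_simp
      rw [mem_Iic, this]
      exact div_nonpos_of_nonpos_of_nonneg (by linarith) hp.le
    have := isClosed_Iic.mem_of_frequently_of_tendsto h2 h1
    rw [mem_Iic] at this
    linarith
  have hder : HasDerivAt (fun η : ℝ => (1 - η) ^ s * L + (1 + η) ^ s * L) 0 0 := by
    have h1 : HasDerivAt (fun η : ℝ => (1 - η) ^ s * L) _ 0 :=
      (((hasDerivAt_id (0 : ℝ)).const_sub 1).rpow_const (p := s) (Or.inl (by simp))).mul_const L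
    have h2 : HasDerivAt (fun η : ℝ => (1 + η) ^ s * L) _ 0 :=
      (((hasDerivAt_id (0 : ℝ)).const_add 1).rpow_const (p := s) (Or.inl (by simp))).mul_const L
    exact (h1.add h2).congr_deriv (by simp)
  have hslope := (hasDerivAt_iff_tendsto_slope_zero.1 hder).mono_left
    (nhdsWithin_mono (0 : ℝ) (s := Ioi 0) fun x (hx : 0 < x) => hx.ne')
  have hbound : ∀ᶠ η in 𝓝[>] (0 : ℝ), η⁻¹ • (((1 - (0 + η)) ^ s * L + (1 + (0 + η)) ^ s * L) -
      ((1 - 0) ^ s * L + (1 + 0) ^ s * L)) ≤ -c := by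
    filter_upwards [Ioo_mem_nhdsGT (show (0 : ℝ) < 1 by norm_num)] with η hη
    have := ineq η hη
    have hη0 := hη.1
    simp only [zero_add, sub_zero, add_zero, Real.one_rpow, one_mul, smul_eq_mul]
    rw [inv_mul_le_iff₀ hη0]
    linarith
  linarith [le_of_tendsto hslope hbound]

/-! ### Words and cut sets -/

section Words

variable {ι : Type*} {S : ι → ℝ → ℝ} {κ : ι → ℕ} {θ : ℝ} {F O : Set ℝ} {K n : ℕ}

/-- The composition `S i₁ ∘ ⋯ ∘ S iₖ` along the word `[i₁, …, iₖ]`. -/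
def wordMap (S : ι → ℝ → ℝ) : List ι → ℝ → ℝ
  | [] => id
  | i :: w => S i ∘ wordMap S w

/-- The sum of the letter weights of a word. -/
def weight (κ : ι → ℕ) (w : List ι) : ℕ := (w.map κ).sum

/-- The words whose weight first reaches `n` at their last letter. -/
def cutSet (κ : ι → ℕ) (n : ℕ) : Set (List ι) :=
  {w | n ≤ weight κ w ∧ weight κ w.dropLast < n}

@[simp] lemma weight_append (u v : List ι) : weight κ (u ++ v) = weight κ u + weight κ v := by
  simp [weight]

@[simp] lemma weight_singleton (i : ι) : weight κ [i] = κ i := by simp [weight]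

@[simp] lemma weight_nil : weight κ ([] : List ι) = 0 := rfl

lemma wordMap_append (u v : List ι) (x : ℝ) :
    wordMap S (u ++ v) x = wordMap S u (wordMap S v x) := by
  induction u with
  | nil => rfl
  | cons i u ih => simp [wordMap, ih]

lemma dist_wordMap (hS : ∀ i x y, dist (S i x) (S i y) = θ ^ κ i * dist x y) (w : List ι)
    (x y : ℝ) : dist (wordMap S w x) (wordMap S w y) = θ ^ weight κ w * dist x y := by
  induction w with
  | nil => simp [wordMap]
  | cons i w ih =>
    rw [← List.singleton_append, weight_append, weight_singleton, pow_add, mul_assoc, ← ih,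
      ← hS]
    rfl

lemma wordMap_mem (hF : ∀ i, S i '' F ⊆ F) (w : List ι) {x : ℝ} (hx : x ∈ F) :
    wordMap S w x ∈ F := by
  induction w with
  | nil => exact hx
  | cons i w ih => exact hF i (mem_image_of_mem _ ih)

lemma ne_nil_of_mem_cutSet {w : List ι} (hw : w ∈ cutSet κ n) : w ≠ [] := by
  rintro rfl
  exact absurd hw.1 hw.2.not_ge

lemma append_mem_cutSet (u : List ι) {v : List ι} (hv : v ∈ cutSet κ n) :
    u ++ v ∈ cutSet κ (weight κ u + n) := by
  have hne := ne_nil_of_mem_cutSet hv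
  obtain ⟨h1, h2⟩ := hv
  refine ⟨by simpa using h1, ?_⟩
  rw [List.dropLast_append_of_ne_nil hne, weight_append]
  omega

lemma mem_cutSet_weight (hκ : ∀ i, 1 ≤ κ i) {w : List ι} (hw : w ≠ []) :
    w ∈ cutSet κ (weight κ w) := by
  refine ⟨le_rfl, ?_⟩
  conv_rhs => rw [← List.dropLast_append_getLast hw]
  rw [weight_append, weight_singleton]
  have := hκ (w.getLast hw)
  omega

lemma weight_lt_of_mem_cutSet (hK : ∀ i, κ i ≤ K) {w : List ι} (hw : w ∈ cutSet κ n) :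
    weight κ w < n + K := by
  have hne := ne_nil_of_mem_cutSet hw
  rw [← List.dropLast_append_getLast hne, weight_append, weight_singleton]
  have := hK (w.getLast hne)
  have := hw.2
  omega

lemma eq_of_prefix_of_mem_cutSet {v w : List ι} (hv : v ∈ cutSet κ n) (hw : w ∈ cutSet κ n)
    (h : v <+: w) : v = w := by
  obtain ⟨s, rfl⟩ := h
  rcases eq_or_ne s [] with rfl | hs
  · simp
  · have h1 := hw.2
    rw [List.dropLast_append_of_ne_nil hs, weight_append] at h1
    have := hv.1
    omega

lemma disjoint_wordMap_image (hinj : ∀ i, Function.Injective (S i)) (hsub : ∀ i, S i '' O ⊆ O)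
    (hdisj : Pairwise fun i j => Disjoint (S i '' O) (S j '' O)) :
    ∀ v w : List ι, ¬ v <+: w → ¬ w <+: v → Disjoint (wordMap S v '' O) (wordMap S w '' O)
  | [], _, h, _ => absurd ⟨_, rfl⟩ h
  | _ :: _, [], _, h => absurd ⟨_, rfl⟩ h
  | i :: v, j :: w, h1, h2 => by
    have key : ∀ (k : ι) (u : List ι), wordMap S (k :: u) '' O = S k '' (wordMap S u '' O) :=
      fun k u => image_comp _ _ _
    have sub : ∀ u : List ι, wordMap S u '' O ⊆ O := fun u => by
      rintro _ ⟨x, hx, rfl⟩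
      exact wordMap_mem hsub u hx
    rw [key, key]
    by_cases hij : i = j
    · subst hij
      rw [List.cons_prefix_cons] at h1 h2
      refine (disjoint_image_iff (hinj i)).2 (disjoint_wordMap_image hinj hsub hdisj v w ?_ ?_)
      · exact fun h => h1 ⟨rfl, h⟩
      · exact fun h => h2 ⟨rfl, h⟩
    · exact (hdisj hij).mono (image_mono (sub v)) (image_mono (sub w))

lemma exists_cutSet_cover [Fintype ι] (hκ : ∀ i, 1 ≤ κ i) (hF : F = ⋃ i, S i '' F) {y : ℝ}
    (hy : ∑ i, y ^ κ i = 1) (n : ℕ) (hn : 1 ≤ n) :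
    ∃ t : Finset (List ι), (∀ w ∈ t, w ∈ cutSet κ n) ∧ ∑ w ∈ t, y ^ weight κ w = 1 ∧
      F ⊆ ⋃ w ∈ t, wordMap S w '' F := by
  classical
  induction n using Nat.strong_induction_on with
  | _ n ih =>
  have step : ∀ i, ∃ s : Finset (List ι), (∀ w ∈ s, [i] ++ w ∈ cutSet κ n) ∧
      ∑ w ∈ s, y ^ weight κ w = 1 ∧ F ⊆ ⋃ w ∈ s, wordMap S w '' F := by
    intro i
    rcases le_or_gt n (κ i) with h | h
    · refine ⟨{[]}, ?_, by simp, by simp [wordMap]⟩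
      simp only [Finset.mem_singleton, forall_eq, List.append_nil]
      exact ⟨by simpa using h, hn⟩
    · have := hκ i
      obtain ⟨s, h1, h2, h3⟩ := ih (n - κ i) (by omega) (by omega)
      refine ⟨s, fun w hw => ?_, h2, h3⟩
      have := append_mem_cutSet [i] (h1 w hw)
      rwa [weight_singleton, Nat.add_sub_cancel' h.le] at this
  choose s hs1 hs2 hs3 using step
  refine ⟨Finset.univ.biUnion fun i => (s i).image fun w => [i] ++ w, ?_, ?_, ?_⟩
  · simp only [Finset.mem_biUnion, Finset.mem_image]
    rintro _ ⟨i, -, w, hw, rfl⟩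
    exact hs1 i w hw
  · rw [Finset.sum_biUnion]
    · rw [← hy]
      refine Finset.sum_congr rfl fun i _ => ?_
      rw [Finset.sum_image fun _ _ _ _ h => List.append_cancel_left h]
      simp only [weight_append, weight_singleton, pow_add]
      rw [← Finset.mul_sum, hs2, mul_one]
    · intro i _ j _ hij
      simp only [Function.onFun, Finset.disjoint_left, Finset.mem_image]
      rintro _ ⟨v, -, rfl⟩ ⟨w, -, h⟩
      exact hij (List.cons.inj h).1.symm
  · intro x hx
    rw [hF] at hx
    obtain ⟨i, z, hz, rfl⟩ := mem_iUnion.1 hx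
    obtain ⟨w, hw, f, hf, rfl⟩ := mem_iUnion₂.1 (hs3 i hz)
    refine mem_iUnion₂.2 ⟨[i] ++ w, ?_, f, hf, rfl⟩
    exact Finset.mem_biUnion.2 ⟨i, Finset.mem_univ _, Finset.mem_image_of_mem _ hw⟩

lemma exists_many_words_of_weight [Fintype ι] (hκ : ∀ i, 1 ≤ κ i) (hK : ∀ i, κ i ≤ K) {y : ℝ}
    (hy : ∑ i, y ^ κ i = 1) {n : ℕ} (hn : 1 ≤ n) :
    ∃ k, n ≤ k ∧ ∃ W : Finset (List ι), (∀ w ∈ W, weight κ w = k) ∧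
      1 ≤ K * (W.card * y ^ k) := by
  classical
  obtain ⟨t, ht, hsum, -⟩ := exists_cutSet_cover (S := fun _ => id) (F := ∅) hκ (by simp) hy n hn
  have hmaps : ∀ w ∈ t, weight κ w ∈ Finset.Ico n (n + K) := fun w hw =>
    Finset.mem_Ico.2 ⟨(ht w hw).1, weight_lt_of_mem_cutSet hK (ht w hw)⟩
  have hfib : ∀ k, ∑ w ∈ t with weight κ w = k, y ^ weight κ w
      = (t.filter fun w => weight κ w = k).card * y ^ k := fun k => by
    rw [Finset.sum_congr rfl fun w hw => by rw [(Finset.mem_filter.1 hw).2], Finset.sum_const,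
      nsmul_eq_mul]
  rw [← Finset.sum_fiberwise_of_maps_to hmaps] at hsum
  simp only [hfib] at hsum
  by_contra! h
  have hne : (Finset.Ico n (n + K)).Nonempty := by
    by_contra hne
    rw [Finset.not_nonempty_iff_eq_empty.1 hne] at hsum
    simp at hsum
  have hKpos : 0 < K := by
    have := Finset.nonempty_Ico.1 hne
    omega
  have := Finset.sum_lt_sum_of_nonempty hne fun k hk =>
    h k (Finset.mem_Ico.1 hk).1 (t.filter fun w => weight κ w = k)
      fun w hw => (Finset.mem_filter.1 hw).2
  rw [← Finset.mul_sum, hsum] at this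
  simp at this

/-! ### Neighbours of a cylinder -/

/-- The words of the cut set of `w` whose cylinder has relative distance at most `T` from the
cylinder of `w`. -/
def neighbours (S : ι → ℝ → ℝ) (κ : ι → ℕ) (θ : ℝ) (F : Set ℝ) (T : ℝ) (w : List ι) :
    Set (List ι) :=
  {v | v ∈ cutSet κ (weight κ w) ∧
    ∃ x ∈ F, ∃ y ∈ F, dist (wordMap S v x) (wordMap S w y) ≤ T * θ ^ weight κ w}

lemma image_append_neighbours_subset (hθ : 0 < θ)
    (hS : ∀ i x y, dist (S i x) (S i y) = θ ^ κ i * dist x y) (T : ℝ) (u w : List ι) :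
    (u ++ ·) '' neighbours S κ θ F T w ⊆ neighbours S κ θ F T (u ++ w) := by
  rintro _ ⟨v, ⟨hv, x, hx, y, hy, hxy⟩, rfl⟩
  refine ⟨by simpa using append_mem_cutSet u hv, x, hx, y, hy, ?_⟩
  rw [wordMap_append, wordMap_append, dist_wordMap hS, weight_append, pow_add]
  calc _ ≤ θ ^ weight κ u * (T * θ ^ weight κ w) := by gcongr
    _ = _ := by ring

lemma exists_card_le_of_subset_neighbours (hθ : 0 < θ) (hθ1 : θ < 1) (hK : ∀ i, κ i ≤ K)
    (hS : ∀ i x y, dist (S i x) (S i y) = θ ^ κ i * dist x y)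
    (hOne : O.Nonempty) (hOopen : IsOpen O) (hObdd : Bornology.IsBounded O)
    (hOsub : ∀ i, S i '' O ⊆ O) (hOdisj : Pairwise fun i j => Disjoint (S i '' O) (S j '' O))
    (hFne : F.Nonempty) {M : ℝ} (hM : ∀ x ∈ O ∪ F, ∀ y ∈ O ∪ F, dist x y ≤ M) (T : ℝ) :
    ∃ C : ℕ, ∀ w, ∀ t : Finset (List ι), ↑t ⊆ neighbours S κ θ F T w → t.card ≤ C := by
  set o := (volume O).toReal
  have hOfin : volume O ≠ ⊤ := hObdd.measure_lt_top.ne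
  have hopos : 0 < o := ENNReal.toReal_pos (hOopen.measure_pos _ hOne).ne' hOfin
  set R := 2 * M + T with hR
  obtain ⟨f, hf⟩ := hFne
  have hM0 : 0 ≤ M := dist_nonneg.trans (hM f (Or.inr hf) f (Or.inr hf))
  have hinj : ∀ i, Function.Injective (S i) := fun i => injective_similarity (pow_pos hθ _) (hS i)
  have hopenv : ∀ v : List ι, MeasurableSet (wordMap S v '' O) := fun v => by
    obtain ⟨c, d, hc, hcd⟩ := exists_affine_of_dist (dist_wordMap hS v)
    have hc0 : c ≠ 0 := abs_pos.1 (hc ▸ pow_pos hθ _)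
    have hcont : Continuous (wordMap S v) := by
      rw [show wordMap S v = fun x => c * x + d from funext hcd]; fun_prop
    exact hOopen.measurableSet.image_of_continuousOn_injOn hcont.continuousOn
      (injective_similarity (pow_pos hθ _) (dist_wordMap hS v)).injOn
  refine ⟨⌊2 * R / (θ ^ K * o)⌋₊, fun w t ht => ?_⟩
  rcases t.eq_empty_or_nonempty with rfl | ⟨v, hv⟩
  · simp
  refine Nat.le_floor ?_
  set n := weight κ w with hn
  have hθn : 0 < θ ^ n := pow_pos hθ n
  have hsub : (⋃ v ∈ t, wordMap S v '' O) ⊆ closedBall (wordMap S w f) (R * θ ^ n) := by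
    refine iUnion₂_subset fun v hv => ?_
    rintro _ ⟨z, hz, rfl⟩
    obtain ⟨hcut, x, hx, y, hy, hxy⟩ := ht hv
    have h1 : dist (wordMap S v z) (wordMap S v x) ≤ θ ^ n * M := by
      rw [dist_wordMap hS]
      exact mul_le_mul (pow_le_pow_of_le_one hθ.le hθ1.le hcut.1)
        (hM z (Or.inl hz) x (Or.inr hx)) dist_nonneg hθn.le
    have h2 : dist (wordMap S w y) (wordMap S w f) ≤ θ ^ n * M := by
      rw [dist_wordMap hS]
      exact mul_le_mul_of_nonneg_left (hM y (Or.inr hy) f (Or.inr hf)) hθn.le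
    have h3 := dist_triangle4 (wordMap S v z) (wordMap S v x) (wordMap S w y) (wordMap S w f)
    rw [mem_closedBall, hR]
    linarith
  have hvol : ∑ v ∈ t, ENNReal.ofReal (θ ^ weight κ v) * volume O
      ≤ ENNReal.ofReal (2 * (R * θ ^ n)) := by
    rw [← Real.volume_closedBall (wordMap S w f)]
    refine le_trans (le_of_eq ?_) (measure_mono hsub)
    rw [measure_biUnion_finset _ fun v _ => hopenv v]
    · exact Finset.sum_congr rfl fun v _ => (volume_image_similarity (dist_wordMap hS v) O).symm
    · intro v hv v' hv' hne
      exact disjoint_wordMap_image hinj hOsub hOdisj v v'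
        (fun h => hne (eq_of_prefix_of_mem_cutSet (ht hv).1 (ht hv').1 h))
        (fun h => hne (eq_of_prefix_of_mem_cutSet (ht hv').1 (ht hv).1 h).symm)
  have hlow : (t.card : ℝ) * (θ ^ (n + K) * o) ≤ ∑ v ∈ t, θ ^ weight κ v * o := by
    rw [← nsmul_eq_mul]
    refine Finset.card_nsmul_le_sum _ _ _ fun v hv => ?_
    exact mul_le_mul_of_nonneg_right (pow_le_pow_of_le_one hθ.le hθ1.le
      (weight_lt_of_mem_cutSet hK (ht hv).1).le) hopos.le
  have hR0 : 0 ≤ R * θ ^ n := by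
    obtain ⟨z, hz⟩ := hOne
    exact nonneg_of_mem_closedBall (hsub (mem_iUnion₂.2 ⟨v, hv, mem_image_of_mem _ hz⟩))
  have hreal := ENNReal.toReal_mono ENNReal.ofReal_ne_top hvol
  rw [ENNReal.toReal_ofReal (by linarith), ENNReal.toReal_sum fun v _ =>
    ENNReal.mul_ne_top ENNReal.ofReal_ne_top hOfin] at hreal
  simp only [ENNReal.toReal_mul, ENNReal.toReal_ofReal (pow_nonneg hθ.le _)] at hreal
  rw [le_div_iff₀ (by positivity)]
  refine le_of_mul_le_mul_right ?_ hθn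
  calc _ = (t.card : ℝ) * (θ ^ (n + K) * o) := by rw [pow_add]; ring
    _ ≤ _ := hlow.trans hreal
    _ = _ := by ring

/-- A word with the maximal number of neighbours stays maximal after prepending any word. -/
lemma exists_neighbours_append_eq [Nonempty ι] (hθ : 0 < θ)
    (hS : ∀ i x y, dist (S i x) (S i y) = θ ^ κ i * dist x y) {T : ℝ} {C : ℕ}
    (hC : ∀ w, ∀ t : Finset (List ι), ↑t ⊆ neighbours S κ θ F T w → t.card ≤ C) :
    ∃ w₀ : List ι, w₀ ≠ [] ∧
      ∀ u, neighbours S κ θ F T (u ++ w₀) = (u ++ ·) '' neighbours S κ θ F T w₀ := by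
  have hfin : ∀ w, (neighbours S κ θ F T w).Finite := fun w => by
    by_contra hinf
    obtain ⟨t, ht, hcard⟩ := Set.Infinite.exists_subset_card_eq hinf (C + 1)
    have := hC w t ht
    omega
  set A : Set ℕ := {n | ∃ w ≠ [], (neighbours S κ θ F T w).ncard = n}
  have hbdd : BddAbove A := ⟨C, by
    rintro _ ⟨w, -, rfl⟩
    rw [ncard_eq_toFinset_card _ (hfin w)]
    exact hC w _ (by simp)⟩
  obtain ⟨i⟩ := ‹Nonempty ι›
  obtain ⟨w₀, hw₀, hmax⟩ := Nat.sSup_mem (s := A) ⟨_, [i], by simp, rfl⟩ hbdd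
  refine ⟨w₀, hw₀, fun u => (eq_of_subset_of_ncard_le
    (image_append_neighbours_subset hθ hS T u w₀) ?_ (hfin _)).symm⟩
  rw [ncard_image_of_injective _ (List.append_right_injective u), hmax]
  exact le_csSup hbdd ⟨u ++ w₀, by simp [hw₀], rfl⟩

/-- Some bounded gap of `F` is mapped to a gap of `F` by every composition of the system. -/
lemma exists_persistent_gap [Fintype ι] [Nonempty ι] (hθ : 0 < θ) (hθ1 : θ < 1)
    (hκ : ∀ i, 1 ≤ κ i)
    (hS : ∀ i x y, dist (S i x) (S i y) = θ ^ κ i * dist x y)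
    (hOne : O.Nonempty) (hOopen : IsOpen O) (hObdd : Bornology.IsBounded O)
    (hOsub : ∀ i, S i '' O ⊆ O) (hOdisj : Pairwise fun i j => Disjoint (S i '' O) (S j '' O))
    (hFc : IsCompact F) (hFnt : F.Nontrivial) (hFinv : F = ⋃ i, S i '' F)
    {y : ℝ} (hy : ∑ i, y ^ κ i = 1) (hvol : volume F = 0) :
    ∃ m ρ : ℝ, 0 < ρ ∧ (∀ u, IsGap F (wordMap S u m) (θ ^ weight κ u * ρ)) ∧
      ∀ u u', weight κ u = weight κ u' → u ≠ u' →
        θ ^ weight κ u * (2 * ρ) ≤ dist (wordMap S u m) (wordMap S u' m) := by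
  obtain ⟨M, hM⟩ := isBounded_iff.1 (hObdd.union hFc.isBounded)
  obtain ⟨f₁, hf₁, f₂, hf₂, hf⟩ := hFnt
  obtain ⟨K, hK⟩ : ∃ K, ∀ i, κ i ≤ K := ⟨∑ i, κ i, fun i =>
    Finset.single_le_sum (fun _ _ => Nat.zero_le _) (Finset.mem_univ i)⟩
  have hFsub : ∀ i, S i '' F ⊆ F := fun i => by
    conv_rhs => rw [hFinv]
    exact subset_iUnion (fun i => S i '' F) i
  obtain ⟨C, hC⟩ := exists_card_le_of_subset_neighbours hθ hθ1 hK hS hOne hOopen hObdd hOsub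
    hOdisj ⟨f₁, hf₁⟩ (fun x hx y hy => hM hx hy) (4 * M)
  obtain ⟨w₀, hw₀, hw⟩ := exists_neighbours_append_eq hθ hS hC
  set b := θ ^ weight κ w₀ with hb
  have hb0 : 0 < b := pow_pos hθ _
  -- a gap close to the cylinder of `w₀`
  obtain ⟨g, hg, m, ρ, hρ, hρM, hmM, hgap⟩ : ∃ g ∈ F, ∃ m ρ, 0 < ρ ∧ ρ ≤ b * M ∧
      dist m (wordMap S w₀ g) ≤ b * M ∧ IsGap F m ρ := by
    have main : ∀ g ∈ F, ∀ g' ∈ F, wordMap S w₀ g < wordMap S w₀ g' →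
        ∃ g ∈ F, ∃ m ρ, 0 < ρ ∧ ρ ≤ b * M ∧ dist m (wordMap S w₀ g) ≤ b * M ∧ IsGap F m ρ := by
      intro g hg g' hg' hlt
      obtain ⟨m, ρ, hρ, h1, h2, h3⟩ := exists_isGap hFc (wordMap_mem hFsub w₀ hg)
        (wordMap_mem hFsub w₀ hg') hlt hvol
      have h4 : dist (wordMap S w₀ g') (wordMap S w₀ g) ≤ b * M := by
        rw [dist_wordMap hS]
        exact mul_le_mul_of_nonneg_left (hM (Or.inr hg') (Or.inr hg)) hb0.le
      rw [Real.dist_eq, abs_of_pos (by linarith)] at h4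
      refine ⟨g, hg, m, ρ, hρ, by linarith, ?_, h3⟩
      rw [Real.dist_eq, abs_of_pos (by linarith)]
      linarith
    have hne : wordMap S w₀ f₁ ≠ wordMap S w₀ f₂ := fun h =>
      hf (injective_similarity hb0 (dist_wordMap hS w₀) h)
    rcases lt_or_gt_of_ne hne with h | h
    · exact main _ hf₁ _ hf₂ h
    · exact main _ hf₂ _ hf₁ h
  have hmu : ∀ u, dist (wordMap S u m) (wordMap S (u ++ w₀) g) ≤ θ ^ weight κ u * (b * M) :=
    fun u => by
      rw [wordMap_append, dist_wordMap hS]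
      exact mul_le_mul_of_nonneg_left hmM (pow_nonneg hθ.le _)
  have hscale : ∀ u, 4 * M * θ ^ weight κ (u ++ w₀) = 4 * (θ ^ weight κ u * (b * M)) := fun u => by
    rw [weight_append, pow_add]; ring
  refine ⟨m, ρ, hρ, fun u => ?_, fun u u' huu hne => ?_⟩
  · have hu : 0 < θ ^ weight κ u := pow_pos hθ _
    have hends : wordMap S u m - θ ^ weight κ u * ρ ∈ F ∧
        wordMap S u m + θ ^ weight κ u * ρ ∈ F := by
      obtain ⟨c, d, hc, hcd⟩ := exists_affine_of_dist (dist_wordMap hS u)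
      have e1 := wordMap_mem hFsub u hgap.1
      have e2 := wordMap_mem hFsub u hgap.2.1
      rw [← hc]
      rw [hcd] at e1 e2 ⊢
      rcases abs_cases c with ⟨h, -⟩ | ⟨h, -⟩ <;> rw [h]
      · exact ⟨by convert e1 using 1; ring, by convert e2 using 1; ring⟩
      · exact ⟨by convert e2 using 1; ring, by convert e1 using 1; ring⟩
    refine ⟨hends.1, hends.2, fun x hx => ?_⟩
    by_contra! hlt
    have hn : 1 ≤ weight κ (u ++ w₀) := by
      have := (mem_cutSet_weight hκ (w := u ++ w₀) (by simp [hw₀])).2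
      omega
    obtain ⟨t, ht, -, hcov⟩ := exists_cutSet_cover hκ hFinv hy _ hn
    obtain ⟨v, hv, z, hz, rfl⟩ := mem_iUnion₂.1 (hcov hx)
    have hvn : v ∈ neighbours S κ θ F (4 * M) (u ++ w₀) := by
      refine ⟨ht v hv, z, hz, g, hg, ?_⟩
      rw [hscale]
      have h1 := dist_triangle (wordMap S v z) (wordMap S u m) (wordMap S (u ++ w₀) g)
      have h2 := hmu u
      have h3 : θ ^ weight κ u * ρ ≤ θ ^ weight κ u * (b * M) := by gcongr
      have h4 : 0 ≤ θ ^ weight κ u * ρ := by positivity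
      linarith
    rw [hw u] at hvn
    obtain ⟨v', -, rfl⟩ := hvn
    simp only [wordMap_append] at hlt
    rw [dist_wordMap hS] at hlt
    exact absurd (lt_of_mul_lt_mul_left hlt hu.le) (hgap.2.2 _ (wordMap_mem hFsub v' hz)).not_gt
  · by_contra! hlt
    have hmem : u' ++ w₀ ∈ neighbours S κ θ F (4 * M) (u ++ w₀) := by
      refine ⟨?_, g, hg, g, hg, ?_⟩
      · rw [weight_append, huu, ← weight_append]
        exact mem_cutSet_weight hκ (by simp [hw₀])
      · rw [hscale]
        have h1 := dist_triangle4 (wordMap S (u' ++ w₀) g) (wordMap S u' m) (wordMap S u m)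
          (wordMap S (u ++ w₀) g)
        have h2 := hmu u
        have h3 := hmu u'
        rw [dist_comm, ← huu] at h3
        rw [dist_comm] at hlt
        have h4 : θ ^ weight κ u * ρ ≤ θ ^ weight κ u * (b * M) := by
          have := pow_nonneg hθ.le (weight κ u)
          gcongr
        linarith
    rw [hw u] at hmem
    obtain ⟨v', -, hv'⟩ := hmem
    refine hne ?_
    have hpos : ∀ l : List ι, weight κ l = 0 → l = [] := fun l hl => by
      by_contra h
      have := (mem_cutSet_weight hκ h).2
      omega
    rcases List.append_eq_append_iff.1 hv' with ⟨s, rfl, -⟩ | ⟨s, rfl, -⟩ <;>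
    · rw [hpos s (by rw [weight_append] at huu; omega), List.append_nil]

end Words

/-! ### Basic properties of the attractor -/

section Attractor

variable {ι : Type*} {S : ι → ℝ → ℝ} {ratio : ι → ℝ} {F O : Set ℝ}

lemma volume_attractor_eq_zero [Fintype ι] (hratio : ∀ i, 0 < ratio i)
    (hS : ∀ i x y, dist (S i x) (S i y) = ratio i * dist x y) (hFc : IsCompact F)
    (hFinv : F = ⋃ i, S i '' F) (hsum : ∑ i, ratio i < 1) : volume F = 0 := by
  have hle : volume F ≤ ENNReal.ofReal (∑ i, ratio i) * volume F := by
    calc volume F = volume (⋃ i, S i '' F) := by rw [← hFinv]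
      _ ≤ ∑ i, volume (S i '' F) := measure_iUnion_fintype_le _ _
      _ = ∑ i, ENNReal.ofReal (ratio i) * volume F :=
        Finset.sum_congr rfl fun i _ => volume_image_similarity (hS i) F
      _ = _ := by rw [← Finset.sum_mul, ENNReal.ofReal_sum_of_nonneg fun i _ => (hratio i).le]
  by_contra h0
  have : ENNReal.ofReal (∑ i, ratio i) * volume F < 1 * volume F :=
    (ENNReal.mul_lt_mul_iff_left h0 hFc.measure_lt_top.ne).2 (by simpa using hsum)
  rw [one_mul] at this
  exact absurd hle this.not_ge

lemma attractor_nontrivial [Nontrivial ι]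
    (hS : ∀ i x y, dist (S i x) (S i y) = ratio i * dist x y) (hOne : O.Nonempty)
    (hOsub : ∀ i, S i '' O ⊆ O) (hOdisj : Pairwise fun i j => Disjoint (S i '' O) (S j '' O))
    (hFne : F.Nonempty) (hFsub : ∀ i, S i '' F ⊆ F) : F.Nontrivial := by
  by_contra hF
  rw [Set.not_nontrivial_iff] at hF
  obtain ⟨p, hp⟩ := hFne
  have hfix : ∀ i, S i p = p := fun i => hF (hFsub i (mem_image_of_mem _ hp)) hp
  have haff : ∀ i, ∃ c, ∀ x, S i x = c * (x - p) + p := fun i => by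
    obtain ⟨c, d, -, hcd⟩ := exists_affine_of_dist (hS i)
    refine ⟨c, fun x => ?_⟩
    have := hfix i
    rw [hcd] at this ⊢
    linarith
  choose c hc using haff
  obtain ⟨i, j, hij⟩ := exists_pair_ne ι
  obtain ⟨z, hz⟩ := hOne
  have hcomm : S i (S j z) = S j (S i z) := by simp only [hc]; ring
  exact Set.disjoint_left.1 (hOdisj hij)
    (mem_image_of_mem _ (hOsub j (mem_image_of_mem _ hz)))
    (hcomm ▸ mem_image_of_mem _ (hOsub i (mem_image_of_mem _ hz)))

end Attractor

lemma exists_lattice_exponents {ι : Type*} {ratio : ι → ℝ}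
    (hratio : ∀ i, ratio i ∈ Ioo (0 : ℝ) 1) {a : ℝ} (ha : 0 < a)
    (hlattice : ∀ i, ∃ k : ℤ, Real.log (ratio i) = a * k) :
    ∃ κ : ι → ℕ, (∀ i, 1 ≤ κ i) ∧ ∀ i, ratio i = Real.exp (-a) ^ κ i := by
  have : ∀ i, ∃ k : ℕ, 1 ≤ k ∧ ratio i = Real.exp (-a) ^ k := fun i => by
    obtain ⟨k, hk⟩ := hlattice i
    have hneg : (k : ℝ) < 0 := by
      have := Real.log_neg (hratio i).1 (hratio i).2
      rw [hk] at this
      exact (pos_iff_neg_of_mul_neg this).1 ha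
    have hk0 : k < 0 := by exact_mod_cast hneg
    refine ⟨(-k).toNat, by omega, ?_⟩
    have hcast : (((-k).toNat : ℕ) : ℝ) = -k := by
      exact_mod_cast Int.toNat_of_nonneg (by omega : 0 ≤ -k)
    rw [← Real.exp_nat_mul, hcast, ← Real.exp_log (hratio i).1, hk]
    ring_nf
  choose κ h1 h2 using this
  exact ⟨κ, h1, h2⟩

lemma frequently_volume_cthickening_defect {ι : Type*} [Fintype ι] {S : ι → ℝ → ℝ} {κ : ι → ℕ}
    {θ ρ m D : ℝ} {F : Set ℝ} {K : ℕ} (hθ : 0 < θ) (hθ1 : θ < 1) (hκ : ∀ i, 1 ≤ κ i)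
    (hK : ∀ i, κ i ≤ K) (hK0 : 0 < K) (hFc : IsCompact F) (hFne : F.Nonempty) (hρ : 0 < ρ)
    (hy : ∑ i, (θ ^ D) ^ κ i = 1)
    (hgap : ∀ u, IsGap F (wordMap S u m) (θ ^ weight κ u * ρ))
    (hsep : ∀ u u', weight κ u = weight κ u' → u ≠ u' →
        θ ^ weight κ u * (2 * ρ) ≤ dist (wordMap S u m) (wordMap S u' m)) :
    ∃ᶠ ε in 𝓝[>] (0 : ℝ), ∀ η ∈ Ioo (0 : ℝ) 1,
      (volume (cthickening ((1 - η) * ε) F)).toReal + (volume (cthickening ((1 + η) * ε) F)).toReal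
        + 2 * ρ ^ D / K * η * ε ^ (1 - D) ≤ 2 * (volume (cthickening ε F)).toReal := by
  have hlim : Tendsto (fun k : ℕ => θ ^ k * ρ) atTop (𝓝[>] 0) := by
    refine tendsto_nhdsWithin_iff.2 ⟨?_, Eventually.of_forall fun k => ?_⟩
    · simpa using (tendsto_pow_atTop_nhds_zero_of_lt_one hθ.le hθ1).mul_const ρ
    · exact mul_pos (pow_pos hθ k) hρ
  refine hlim.frequently (frequently_atTop'.2 fun n => ?_)
  obtain ⟨k, hnk, W, hW, hcard⟩ := exists_many_words_of_weight hκ hK hy (n := n + 1) (by omega)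
  refine ⟨k, by omega, fun η hη => ?_⟩
  set ε := θ ^ k * ρ with hε
  have hθk : 0 < θ ^ k := pow_pos hθ k
  have hε0 : 0 < ε := by positivity
  have hη0 := hη.1
  have h2 := volume_cthickening_second_difference hFc hFne W (fun u => wordMap S u m)
    (ε := ε) (h := η * ε) (by positivity) (by nlinarith [hη.2])
    (fun u hu => by simpa [hW u hu] using hgap u)
    (fun u hu u' hu' hne => by
      refine ball_disjoint_ball ?_
      have := hsep u u' ((hW u hu).trans (hW u' hu').symm) hne
      rw [hW u hu] at this
      refine le_trans ?_ this
      nlinarith [hη.2])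
  have hpow : ε ^ (1 - D) * (θ ^ D) ^ k * ρ ^ D = ε := by
    have h3 : (θ ^ D) ^ k = (θ ^ k) ^ D := by
      rw [← Real.rpow_natCast, ← Real.rpow_mul hθ.le, mul_comm, Real.rpow_mul hθ.le,
        Real.rpow_natCast]
    rw [h3, mul_assoc, ← Real.mul_rpow hθk.le hρ.le, ← Real.rpow_add hε0]
    simp
  have hterm : 2 * ρ ^ D / K * η * ε ^ (1 - D) ≤ 2 * (η * ε) * W.card := by
    have hK' : (0 : ℝ) < K := by exact_mod_cast hK0
    have hs : 0 < ε ^ (1 - D) := Real.rpow_pos_of_pos hε0 _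
    have hr : 0 < ρ ^ D := Real.rpow_pos_of_pos hρ _
    calc 2 * ρ ^ D / K * η * ε ^ (1 - D)
        = (2 * ρ ^ D / K * η * ε ^ (1 - D)) * 1 := (mul_one _).symm
      _ ≤ (2 * ρ ^ D / K * η * ε ^ (1 - D)) * (K * (W.card * (θ ^ D) ^ k)) := by gcongr
      _ = 2 * (η * (ε ^ (1 - D) * (θ ^ D) ^ k * ρ ^ D)) * W.card := by field_simp
      _ = _ := by rw [hpow]
  rw [show (1 - η) * ε = ε - η * ε by ring, show (1 + η) * ε = ε + η * ε by ring]
  linarith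

end LatticeSelfSimilar

/-- (Falconer; Kombrink–Winter) Let `S₁, …, S_N : ℝ → ℝ` (`N ≥ 2`) be contracting similarities
with ratios `r₁, …, r_N ∈ (0,1)` satisfying the open set condition, let `F` be the attractor
and `D < 1` the real number with `Σ rᵢ^D = 1`. If the system is lattice (there is some `a > 0`
with `log rᵢ ∈ a·ℤ` for all `i`), then `F` is not Minkowski measurable: the limit
`lim_{ε→0⁺} λ¹(F_ε)/ε^(1-D)` does not exist as a number in `(0, ∞)`. -/
theorem stmt_13 (N : ℕ) (hN : 2 ≤ N)
    (S : Fin N → ℝ → ℝ)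
    (ratio : Fin N → ℝ) (hratio : ∀ i, ratio i ∈ Set.Ioo (0 : ℝ) 1)
    (hsim : ∀ i x y, dist (S i x) (S i y) = ratio i * dist x y)
    (O : Set ℝ) (hOne : O.Nonempty) (hOopen : IsOpen O)
    (hObdd : Bornology.IsBounded O)
    (hOsub : ∀ i, S i '' O ⊆ O)
    (hOdisj : Pairwise fun i j => Disjoint (S i '' O) (S j '' O))
    (F : Set ℝ) (hFc : IsCompact F) (hFne : F.Nonempty)
    (hFinv : F = ⋃ i, S i '' F)
    (D : ℝ) (hD : ∑ i, ratio i ^ D = 1) (hD1 : D < 1)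
    (hlattice : ∃ a : ℝ, 0 < a ∧ ∀ i, ∃ k : ℤ, Real.log (ratio i) = a * k) :
    ¬ ∃ L : ℝ, 0 < L ∧
        Filter.Tendsto
          (fun ε : ℝ => (volume (cthickening ε F)).toReal / ε ^ ((1 : ℝ) - D))
          (𝓝[>] 0) (𝓝 L) := by
  rintro ⟨L, -, hL⟩
  obtain ⟨a, ha, hlat⟩ := hlattice
  obtain ⟨κ, hκ, hκr⟩ := LatticeSelfSimilar.exists_lattice_exponents hratio ha hlat
  set θ := Real.exp (-a) with hθ
  have hθ0 : 0 < θ := Real.exp_pos _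
  have hθ1 : θ < 1 := by rw [hθ, Real.exp_lt_one_iff]; linarith
  have hFsub : ∀ i, S i '' F ⊆ F := fun i => by
    conv_rhs => rw [hFinv]
    exact subset_iUnion (fun i => S i '' F) i
  have : Nontrivial (Fin N) := Fin.nontrivial_iff_two_le.2 hN
  have hsum : ∑ i, ratio i < 1 := by
    rw [← hD]
    refine Finset.sum_lt_sum_of_nonempty Finset.univ_nonempty fun i _ => ?_
    simpa using Real.rpow_lt_rpow_of_exponent_gt (hratio i).1 (hratio i).2 hD1
  have hvol := LatticeSelfSimilar.volume_attractor_eq_zero (fun i => (hratio i).1) hsim hFc hFinv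
    hsum
  have hnt := LatticeSelfSimilar.attractor_nontrivial hsim hOne hOsub hOdisj hFne hFsub
  have hy : ∑ i, (θ ^ D) ^ κ i = 1 := by
    rw [← hD]
    refine Finset.sum_congr rfl fun i _ => ?_
    rw [hκr i, ← Real.rpow_natCast, ← Real.rpow_natCast, ← Real.rpow_mul hθ0.le,
      ← Real.rpow_mul hθ0.le, mul_comm]
  have hS : ∀ i x y, dist (S i x) (S i y) = θ ^ κ i * dist x y := fun i x y => by
    rw [hsim, hκr]
  obtain ⟨m, ρ, hρ, hgap, hsep⟩ := LatticeSelfSimilar.exists_persistent_gap hθ0 hθ1 hκ hS hOne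
    hOopen hObdd hOsub hOdisj hFc hnt hFinv hy hvol
  have hK : ∀ i, κ i ≤ ∑ i, κ i := fun i =>
    Finset.single_le_sum (fun _ _ => Nat.zero_le _) (Finset.mem_univ i)
  have hK0 : 0 < ∑ i, κ i :=
    (hκ (Classical.arbitrary _)).trans (hK _)
  refine LatticeSelfSimilar.not_tendsto_div_rpow ?_
    (LatticeSelfSimilar.frequently_volume_cthickening_defect hθ0 hθ1 hκ hK hK0 hFc hFne hρ hy
      hgap hsep) hL
  have := Real.rpow_pos_of_pos hρ D
  have : (0 : ℝ) < (∑ i, κ i : ℕ) := by exact_mod_cast hK0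
  positivity
end

section
/- Let r > 2. Then the Minkowski dimension of the Cantor dust C^r exists and equals D_r = log 4 / log r; that is, lim_{ε→0⁺} (log λ²((C^r)_ε)) / (log ε) = 2 − log 4 / log r. Moreover, the Hausdorff dimension of C^r also equals log 4 / log r. -/
open MeasureTheory Metric Set Real Filter Topology ENNReal

/-- The similarity map `x ↦ x/r + (a, b)` of the plane. -/
noncomputable def cantorMap (r a b : ℝ) (x : EuclideanSpace ℝ (Fin 2)) :
    EuclideanSpace ℝ (Fin 2) :=
  r⁻¹ • x + (WithLp.equiv 2 (Fin 2 → ℝ)).symm ![a, b]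

/-- `C` is the Cantor dust with parameter `r`: the (unique) nonempty compact set invariant
under the four similarities `S₁, S₂, S₃, S₄`. -/
def IsCantorDust (r : ℝ) (C : Set (EuclideanSpace ℝ (Fin 2))) : Prop :=
  IsCompact C ∧ C.Nonempty ∧
    C = cantorMap r 0 0 '' C ∪ cantorMap r ((r - 1) / r) 0 '' C ∪
        cantorMap r ((r - 1) / r) ((r - 1) / r) '' C ∪ cantorMap r 0 ((r - 1) / r) '' C

lemma fin_two_natCast_mem_Icc (k : Fin 2) : ((k : ℕ) : ℝ) ∈ Icc (0 : ℝ) 1 := by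
  refine ⟨by positivity, ?_⟩
  exact_mod_cast Nat.lt_succ_iff.1 k.2

/-- A positive monotone function that is log-periodic up to the power `ε ^ p` near `0`
has logarithmic exponent `p` at `0`. -/
lemma tendsto_log_div_log_of_scaling {V : ℝ → ℝ} {r p ε₀ : ℝ} (hr : 1 < r) (hε₀ : 0 < ε₀)
    (hpos : ∀ ε, 0 < ε → 0 < V ε) (hmono : Monotone V)
    (hscale : ∀ ε, 0 < ε → ε < ε₀ → V ε = r ^ (-p) * V (r * ε)) :
    Tendsto (fun ε => log (V ε) / log ε) (𝓝[>] 0) (𝓝 p) := by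
  have hr0 : 0 < r := by linarith
  have hstep : ∀ ε, 0 < ε → ε < ε₀ →
      log (V ε) - p * log ε = log (V (r * ε)) - p * log (r * ε) := by
    intro ε h0 h1
    rw [hscale ε h0 h1, log_mul (by positivity) (hpos _ (by positivity)).ne', log_rpow hr0,
      log_mul hr0.ne' h0.ne']
    ring
  have hiter : ∀ ε, 0 < ε → ∀ n : ℕ, r ^ n * ε ≤ ε₀ →
      log (V ε) - p * log ε = log (V (r ^ n * ε)) - p * log (r ^ n * ε) := by
    intro ε h0 n
    induction n with
    | zero => simp
    | succ n ih =>
      intro h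
      have h2 : r ^ n * ε < r * (r ^ n * ε) := lt_mul_of_one_lt_left (by positivity) hr
      have h3 : r ^ (n + 1) * ε = r * (r ^ n * ε) := by ring
      rw [h3] at h ⊢
      rw [ih (by linarith), hstep _ (by positivity) (by linarith)]
  obtain ⟨M, hM⟩ : ∃ M : ℝ, ∀ ε, 0 < ε → ε < ε₀ → |log (V ε) - p * log ε| ≤ M := by
    refine ⟨|log (V (ε₀ / r))| + |log (V ε₀)| + |p| * (|log (ε₀ / r)| + |log ε₀|), ?_⟩
    intro ε h0 h1
    obtain ⟨n, hn, hn'⟩ := exists_nat_pow_near (x := ε₀ / ε) (by rw [le_div_iff₀ h0]; linarith) hr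
    rw [le_div_iff₀ h0] at hn
    rw [div_lt_iff₀ h0, pow_succ] at hn'
    have hδ : 0 < r ^ n * ε := by positivity
    have hlow : ε₀ / r ≤ r ^ n * ε := by rw [div_le_iff₀ hr0]; nlinarith
    have hlow0 : 0 < ε₀ / r := by positivity
    rw [hiter ε h0 n hn]
    have hbound : ∀ {x y z : ℝ}, x ≤ y → y ≤ z → |y| ≤ |x| + |z| := by
      intro x y z h h'
      exact (abs_le_max_abs_abs h h').trans
        (max_le_add_of_nonneg (abs_nonneg _) (abs_nonneg _))
    have hV := hbound (log_le_log (hpos _ hlow0) (hmono hlow))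
      (log_le_log (hpos _ hδ) (hmono hn))
    have hl := hbound (log_le_log hlow0 hlow) (log_le_log hδ hn)
    calc _ ≤ |log (V (r ^ n * ε))| + |p * log (r ^ n * ε)| := abs_sub _ _
      _ ≤ _ := by
        rw [abs_mul]
        gcongr
  have hlog : Tendsto (fun ε : ℝ => M * |log ε|⁻¹) (𝓝[>] 0) (𝓝 0) := by
    have := (tendsto_abs_atBot_atTop.comp tendsto_log_nhdsGT_zero).inv_tendsto_atTop
    simpa using this.const_mul M
  rw [tendsto_iff_norm_sub_tendsto_zero]
  refine squeeze_zero' (Eventually.of_forall fun _ => norm_nonneg _) ?_ hlog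
  have hsmall : ∀ᶠ ε in 𝓝[>] (0 : ℝ), ε ∈ Ioo 0 (min ε₀ 1) :=
    Ioo_mem_nhdsGT (lt_min hε₀ one_pos)
  filter_upwards [hsmall] with ε hε
  have hl : log ε ≠ 0 := (log_neg hε.1 (hε.2.trans_le (min_le_right _ _))).ne
  have heq : log (V ε) / log ε - p = (log (V ε) - p * log ε) / log ε := by field_simp
  rw [heq, norm_eq_abs, abs_div, div_eq_mul_inv]
  gcongr
  exact hM ε hε.1 (hε.2.trans_le (min_le_left _ _))

/-- The similarity of the Cantor dust whose corner is selected by `e`. -/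
noncomputable def cantorSim (r : ℝ) (e : Fin 2 → Fin 2) :
    EuclideanSpace ℝ (Fin 2) → EuclideanSpace ℝ (Fin 2) :=
  cantorMap r ((e 0 : ℕ) * ((r - 1) / r)) ((e 1 : ℕ) * ((r - 1) / r))

lemma cantorSim_apply (r : ℝ) (e : Fin 2 → Fin 2) (x : EuclideanSpace ℝ (Fin 2)) (i : Fin 2) :
    cantorSim r e x i = (x i + (e i : ℕ) * (r - 1)) / r := by
  fin_cases i <;> simp [cantorSim, cantorMap] <;> ring

lemma IsCantorDust.eq_iUnion {r : ℝ} {C : Set (EuclideanSpace ℝ (Fin 2))}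
    (hC : IsCantorDust r C) : C = ⋃ e, cantorSim r e '' C := by
  have h := hC.2.2
  apply Subset.antisymm
  · intro x hx
    rw [h] at hx
    rw [mem_iUnion]
    rcases hx with ((hx | hx) | hx) | hx
    · exact ⟨![0, 0], by simpa [cantorSim] using hx⟩
    · exact ⟨![1, 0], by simpa [cantorSim] using hx⟩
    · exact ⟨![1, 1], by simpa [cantorSim] using hx⟩
    · exact ⟨![0, 1], by simpa [cantorSim] using hx⟩
  · refine iUnion_subset fun e => ?_
    intro x hx
    rw [h]
    have h0 : e 0 = 0 ∨ e 0 = 1 := by omega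
    have h1 : e 1 = 0 ∨ e 1 = 1 := by omega
    unfold cantorSim at hx
    rcases h0 with h0 | h0 <;> rcases h1 with h1 | h1 <;> simp only [h0, h1] at hx
    · exact Or.inl (Or.inl (Or.inl (by simpa using hx)))
    · exact Or.inr (by simpa using hx)
    · exact Or.inl (Or.inl (Or.inr (by simpa using hx)))
    · exact Or.inl (Or.inr (by simpa using hx))

lemma IsCantorDust.exists_eq_cantorSim {r : ℝ} {C : Set (EuclideanSpace ℝ (Fin 2))}
    (hC : IsCantorDust r C) {x : EuclideanSpace ℝ (Fin 2)} (hx : x ∈ C) :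
    ∃ e, ∃ y ∈ C, cantorSim r e y = x := by
  rw [hC.eq_iUnion] at hx
  simpa using hx

lemma IsCantorDust.cantorSim_mem {r : ℝ} {C : Set (EuclideanSpace ℝ (Fin 2))}
    (hC : IsCantorDust r C) (e : Fin 2 → Fin 2) {x : EuclideanSpace ℝ (Fin 2)} (hx : x ∈ C) :
    cantorSim r e x ∈ C := by
  rw [hC.eq_iUnion]
  exact mem_iUnion.2 ⟨e, x, hx, rfl⟩

lemma dist_cantorSim {r : ℝ} (hr : 0 < r) (e : Fin 2 → Fin 2)
    (x y : EuclideanSpace ℝ (Fin 2)) :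
    dist (cantorSim r e x) (cantorSim r e y) = r⁻¹ * dist x y := by
  rw [cantorSim, cantorMap, cantorMap, dist_add_right, dist_smul₀, norm_eq_abs,
    abs_of_pos (by positivity)]

lemma IsCantorDust.apply_mem_Icc {r : ℝ} (hr : 1 < r) {C : Set (EuclideanSpace ℝ (Fin 2))}
    (hC : IsCantorDust r C) {x : EuclideanSpace ℝ (Fin 2)} (hx : x ∈ C) (i : Fin 2) :
    x i ∈ Icc (0 : ℝ) 1 := by
  have hr0 : 0 < r := by linarith
  have hcont : ContinuousOn (fun x : EuclideanSpace ℝ (Fin 2) => x i) C := by fun_prop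
  constructor
  · obtain ⟨z, hz, hmin⟩ := hC.1.exists_isMinOn hC.2.1 hcont
    refine le_trans ?_ (hmin hx)
    obtain ⟨e, y, hy, rfl⟩ := hC.exists_eq_cantorSim hz
    have h := hmin hy
    simp only [mem_ofPred_eq, cantorSim_apply] at h ⊢
    rw [div_le_iff₀ hr0] at h
    have := mul_nonneg (fin_two_natCast_mem_Icc (e i)).1 (by linarith : 0 ≤ r - 1)
    apply div_nonneg _ hr0.le
    nlinarith
  · obtain ⟨z, hz, hmax⟩ := hC.1.exists_isMaxOn hC.2.1 hcont
    refine le_trans (hmax hx) ?_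
    obtain ⟨e, y, hy, rfl⟩ := hC.exists_eq_cantorSim hz
    have h := hmax hy
    simp only [mem_ofPred_eq, cantorSim_apply] at h ⊢
    rw [le_div_iff₀ hr0] at h
    have := mul_le_mul_of_nonneg_right (fin_two_natCast_mem_Icc (e i)).2
      (by linarith : 0 ≤ r - 1)
    rw [div_le_iff₀ hr0]
    nlinarith

/-- Points of `[0, 1]` placed in different first-level intervals are at distance at least
`(r - 2) / r`. -/
lemma eq_of_dist_lt_gap {r : ℝ} (hr : 2 < r) {s t : ℝ} (hs : s ∈ Icc (0 : ℝ) 1)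
    (ht : t ∈ Icc (0 : ℝ) 1) {j k : Fin 2}
    (h : |(s + (j : ℕ) * (r - 1)) / r - (t + (k : ℕ) * (r - 1)) / r| < (r - 2) / r) : j = k := by
  have hr0 : 0 < r := by linarith
  rw [← sub_div, abs_div, abs_of_pos hr0, div_lt_div_iff_of_pos_right hr0, abs_lt] at h
  obtain ⟨hs0, hs1⟩ := hs
  obtain ⟨ht0, ht1⟩ := ht
  fin_cases j <;> fin_cases k <;> simp at h ⊢ <;> linarith [h.1, h.2]

lemma cthickening_cantorSim_image {r : ℝ} (hr : 0 < r) (e : Fin 2 → Fin 2)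
    {C : Set (EuclideanSpace ℝ (Fin 2))} (hC : IsCompact C) {ε : ℝ} (hε : 0 ≤ ε) :
    cthickening ε (cantorSim r e '' C) = cantorSim r e '' cthickening (r * ε) C := by
  have hcont : Continuous (cantorSim r e) := by
    unfold cantorSim cantorMap
    fun_prop
  rw [(hC.image hcont).cthickening_eq_biUnion_closedBall hε,
    hC.cthickening_eq_biUnion_closedBall (by positivity)]
  have hsurj : Function.Surjective (cantorSim r e) := by
    intro y
    refine ⟨WithLp.toLp 2 fun i => r * y i - (e i : ℕ) * (r - 1), ?_⟩
    ext i
    rw [cantorSim_apply]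
    field_simp
    ring
  ext y
  obtain ⟨z, rfl⟩ := hsurj y
  have hinj : Function.Injective (cantorSim r e) := by
    intro a b hab
    have := dist_cantorSim hr e a b
    rw [hab, dist_self] at this
    have hr' : r⁻¹ ≠ 0 := by positivity
    exact dist_eq_zero.1 ((mul_eq_zero.1 this.symm).resolve_left hr')
  rw [hinj.mem_set_image]
  simp only [biUnion_image, mem_iUnion, mem_closedBall, dist_cantorSim hr, inv_mul_le_iff₀ hr]

lemma volume_cantorSim_image {r : ℝ} (hr : 0 < r) (e : Fin 2 → Fin 2)
    (A : Set (EuclideanSpace ℝ (Fin 2))) :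
    volume (cantorSim r e '' A) = ENNReal.ofReal (r⁻¹ ^ 2) * volume A := by
  unfold cantorSim cantorMap
  rw [← image_image (fun x => x + _) (fun x => r⁻¹ • x), image_add_right,
    measure_preimage_add_right, image_smul, Measure.addHaar_smul, finrank_euclideanSpace_fin,
    abs_of_pos (by positivity)]

lemma cthickening_iUnion_of_finite {ι X : Type*} [Finite ι] [PseudoEMetricSpace X] (δ : ℝ)
    (s : ι → Set X) : cthickening δ (⋃ i, s i) = ⋃ i, cthickening δ (s i) := by
  ext x
  simp only [cthickening, mem_ofPred_eq, mem_iUnion, infEDist_iUnion]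
  constructor
  · intro h
    by_contra! hne
    rcases isEmpty_or_nonempty ι with hι | hι
    · simp [iInf_of_empty] at h
    · obtain ⟨i, hi⟩ := exists_eq_ciInf_of_finite (f := fun i => infEDist x (s i))
      exact (hne i).not_ge (hi ▸ h)
  · rintro ⟨i, hi⟩
    exact (iInf_le _ i).trans hi

lemma IsCantorDust.volume_cthickening {r : ℝ} (hr : 2 < r) {C : Set (EuclideanSpace ℝ (Fin 2))}
    (hC : IsCantorDust r C) {ε : ℝ} (hε : 0 ≤ ε) (hε' : ε < (r - 2) / r / 2) :
    volume (cthickening ε C) =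
      4 * (ENNReal.ofReal (r⁻¹ ^ 2) * volume (cthickening (r * ε) C)) := by
  have hr0 : 0 < r := by linarith
  have hcont : ∀ e, Continuous (cantorSim r e) := by
    intro e
    unfold cantorSim cantorMap
    fun_prop
  conv_lhs => rw [hC.eq_iUnion]
  rw [cthickening_iUnion_of_finite, measure_iUnion _ fun e => isClosed_cthickening.measurableSet]
  · simp only [cthickening_cantorSim_image hr0 _ hC.1 hε, volume_cantorSim_image hr0, tsum_fintype]
    simp
  · intro e e' hne
    rw [Function.onFun, disjoint_left]
    intro z hz hz'
    apply hne
    rw [(hC.1.image (hcont _)).cthickening_eq_biUnion_closedBall hε] at hz hz'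
    simp only [biUnion_image, mem_iUnion, mem_closedBall] at hz hz'
    obtain ⟨x, hx, hzx⟩ := hz
    obtain ⟨y, hy, hzy⟩ := hz'
    ext1 i
    apply eq_of_dist_lt_gap hr (hC.apply_mem_Icc (by linarith) hx i)
      (hC.apply_mem_Icc (by linarith) hy i)
    rw [← cantorSim_apply, ← cantorSim_apply]
    calc _ ≤ dist (cantorSim r e x) (cantorSim r e' y) := by
          rw [dist_eq_norm]
          exact PiLp.norm_apply_le (cantorSim r e x - cantorSim r e' y) i
      _ ≤ ε + ε := (dist_triangle_left _ _ z).trans (add_le_add hzx hzy)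
      _ < _ := by linarith

lemma IsCantorDust.tendsto_log_volume_cthickening {r : ℝ} (hr : 2 < r)
    {C : Set (EuclideanSpace ℝ (Fin 2))} (hC : IsCantorDust r C) :
    Tendsto (fun ε : ℝ => log (volume (cthickening ε C)).toReal / log ε)
      (𝓝[>] 0) (𝓝 (2 - Real.log 4 / Real.log r)) := by
  have hr0 : 0 < r := by linarith
  have hfin : ∀ ε, volume (cthickening ε C) ≠ ∞ := fun ε => hC.1.cthickening.measure_ne_top
  refine tendsto_log_div_log_of_scaling (r := r) (ε₀ := (r - 2) / r / 2) (by linarith)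
    (div_pos (div_pos (by linarith) hr0) two_pos) ?_ ?_ ?_
  · intro ε hε
    refine ENNReal.toReal_pos ?_ (hfin ε)
    obtain ⟨x, hx⟩ := hC.2.1
    exact ((measure_closedBall_pos volume x hε).trans_le
      (measure_mono (closedBall_subset_cthickening hx ε))).ne'
  · intro ε ε' h
    exact ENNReal.toReal_mono (hfin _) (measure_mono (cthickening_mono h C))
  · intro ε hε hε'
    have hlog : log r ≠ 0 := (log_pos (by linarith)).ne'
    have hpow : r ^ (-(2 - Real.log 4 / Real.log r)) = 4 * r⁻¹ ^ 2 := by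
      rw [neg_sub, rpow_sub hr0, rpow_def_of_pos hr0, mul_div_cancel₀ _ hlog,
        Real.exp_log (by norm_num), Real.rpow_two, inv_pow, div_eq_mul_inv]
    rw [hpow, hC.volume_cthickening hr hε.le hε']
    simp only [ENNReal.toReal_mul, ENNReal.toReal_ofNat]
    rw [ENNReal.toReal_ofReal (by positivity)]
    ring

/-- Words of length `n` in the four similarities, applied to `C`. -/
noncomputable def cantorPiece (r : ℝ) (C : Set (EuclideanSpace ℝ (Fin 2))) :
    (n : ℕ) → (Fin n → Fin 2 → Fin 2) → Set (EuclideanSpace ℝ (Fin 2))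
  | 0, _ => C
  | n + 1, w => cantorSim r (w 0) '' cantorPiece r C n (Fin.tail w)

lemma IsCantorDust.subset_iUnion_cantorPiece {r : ℝ} {C : Set (EuclideanSpace ℝ (Fin 2))}
    (hC : IsCantorDust r C) (n : ℕ) : C ⊆ ⋃ w, cantorPiece r C n w := by
  induction n with
  | zero => exact fun x hx => mem_iUnion.2 ⟨Fin.elim0, hx⟩
  | succ n ih =>
    intro x hx
    obtain ⟨e, y, hy, rfl⟩ := hC.exists_eq_cantorSim hx
    obtain ⟨w, hw⟩ := mem_iUnion.1 (ih hy)
    exact mem_iUnion.2 ⟨Fin.cons e w, y, by simpa using hw, by simp⟩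

lemma ediam_cantorPiece_le {r : ℝ} (hr : 0 < r) (C : Set (EuclideanSpace ℝ (Fin 2))) (n : ℕ)
    (w : Fin n → Fin 2 → Fin 2) :
    ediam (cantorPiece r C n w) ≤ ENNReal.ofReal (r⁻¹ ^ n) * ediam C := by
  induction n with
  | zero => simp [cantorPiece]
  | succ n ih =>
    have hlip : LipschitzWith r⁻¹.toNNReal (cantorSim r (w 0)) :=
      LipschitzWith.of_dist_le_mul fun x y => by
        rw [dist_cantorSim hr, coe_toNNReal _ (by positivity)]
    calc _ ≤ _ := hlip.ediam_image_le _
      _ ≤ ENNReal.ofReal r⁻¹ * (ENNReal.ofReal (r⁻¹ ^ n) * ediam C) := by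
        gcongr
        exacts [le_rfl, ih _]
      _ = _ := by
        rw [← mul_assoc, ← ENNReal.ofReal_mul (by positivity), pow_succ']

lemma IsCantorDust.dimH_le {r : ℝ} (hr : 1 < r) {C : Set (EuclideanSpace ℝ (Fin 2))}
    (hC : IsCantorDust r C) : dimH C ≤ ENNReal.ofReal (Real.log 4 / Real.log r) := by
  have hr0 : 0 < r := by linarith
  have hlogr : 0 < Real.log r := log_pos hr
  set s := Real.log 4 / Real.log r with hs
  have hs0 : 0 ≤ s := div_nonneg (log_nonneg (by norm_num)) hlogr.le
  have hrs : r ^ s = 4 := by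
    rw [rpow_def_of_pos hr0, hs, mul_div_cancel₀ _ hlogr.ne', Real.exp_log (by norm_num)]
  have hdiam : ediam C ≠ ∞ := hC.1.isBounded.ediam_ne_top
  have htend : Tendsto (fun n : ℕ => ENNReal.ofReal (r⁻¹ ^ n) * ediam C) atTop (𝓝 0) := by
    have h := (ENNReal.tendsto_ofReal (tendsto_pow_atTop_nhds_zero_of_lt_one
      (inv_nonneg.2 hr0.le) (inv_lt_one_of_one_lt₀ hr)))
    simpa using ENNReal.Tendsto.mul_const h (Or.inr hdiam)
  have hle := Measure.hausdorffMeasure_le_liminf_sum s C _ htend (cantorPiece r C)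
    (Eventually.of_forall fun n => ediam_cantorPiece_le hr0 C n)
    (Eventually.of_forall hC.subset_iUnion_cantorPiece)
  have hsum : ∀ n : ℕ, ∑ w, ediam (cantorPiece r C n w) ^ s ≤ ediam C ^ s := by
    intro n
    calc _ ≤ ∑ _w : Fin n → Fin 2 → Fin 2, (ENNReal.ofReal (r⁻¹ ^ n) * ediam C) ^ s := by
          gcongr with w
          exact ediam_cantorPiece_le hr0 C n w
      _ = ENNReal.ofReal (4 ^ n * (r⁻¹ ^ n) ^ s) * ediam C ^ s := by
          rw [ENNReal.mul_rpow_of_nonneg _ _ hs0, ENNReal.ofReal_rpow_of_pos (by positivity),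
            ENNReal.ofReal_mul (by positivity), mul_assoc]
          simp
      _ = _ := by
          rw [← rpow_natCast_mul (by positivity), mul_comm (n : ℝ), rpow_mul_natCast (by positivity),
            inv_rpow hr0.le, hrs, ← mul_pow]
          norm_num
  have hfin : μH[(⟨s, hs0⟩ : NNReal)] C ≠ ∞ := by
    refine ne_top_of_le_ne_top (ENNReal.rpow_ne_top_of_nonneg hs0 hdiam) (hle.trans ?_)
    exact liminf_le_of_le (by isBoundedDefault) fun b hb => by
      obtain ⟨n, hn⟩ := hb.exists
      exact hn.trans (hsum n)
  refine (dimH_le_of_hausdorffMeasure_ne_top hfin).trans_eq ?_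
  rw [ENNReal.ofReal, toNNReal_of_nonneg hs0]
  rfl

/-- The first digit of a point of the Cantor set on the line. -/
noncomputable def cantorDigit (t : ℝ) : ℕ := if 1 / 2 < t then 1 else 0

/-- The expanding map whose inverse branches generate the Cantor set on the line. -/
noncomputable def cantorShift (r t : ℝ) : ℝ := r * t - cantorDigit t * (r - 1)

/-- The Cantor function: it reads the digits of a point of the Cantor set in base two. -/
noncomputable def cantorStaircase (r t : ℝ) : ℝ :=
  ∑' n : ℕ, cantorDigit ((cantorShift r)^[n] t) * (1 / 2 : ℝ) ^ (n + 1)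

lemma cantorDigit_le_one (t : ℝ) : (cantorDigit t : ℝ) ≤ 1 := by
  unfold cantorDigit
  split_ifs <;> simp

lemma hasSum_half_pow_succ : HasSum (fun n : ℕ => (1 / 2 : ℝ) ^ (n + 1)) 1 := by
  simpa [pow_succ] using hasSum_geometric_two.mul_right (1 / 2 : ℝ)

lemma summable_cantorStaircase (r t : ℝ) :
    Summable fun n : ℕ => cantorDigit ((cantorShift r)^[n] t) * (1 / 2 : ℝ) ^ (n + 1) :=
  hasSum_half_pow_succ.summable.of_nonneg_of_le (fun _ => by positivity) fun _ =>
    mul_le_of_le_one_left (by positivity) (cantorDigit_le_one _)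

lemma cantorStaircase_mem_Icc (r t : ℝ) : cantorStaircase r t ∈ Icc (0 : ℝ) 1 := by
  refine ⟨tsum_nonneg fun _ => by positivity, ?_⟩
  rw [← hasSum_half_pow_succ.tsum_eq]
  exact (summable_cantorStaircase r t).tsum_le_tsum
    (fun _ => mul_le_of_le_one_left (by positivity) (cantorDigit_le_one _))
    hasSum_half_pow_succ.summable

lemma cantorStaircase_eq (r t : ℝ) :
    cantorStaircase r t = (cantorDigit t + cantorStaircase r (cantorShift r t)) / 2 := by
  rw [cantorStaircase, (summable_cantorStaircase r t).tsum_eq_zero_add, cantorStaircase, add_div,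
    ← tsum_div_const]
  congr 1
  · simp [div_eq_mul_inv]
  · refine tsum_congr fun n => ?_
    rw [Function.iterate_succ_apply, pow_succ _ (n + 1)]
    ring

lemma cantorStaircase_branch {r : ℝ} (hr : 2 < r) {u : ℝ} (hu : u ∈ Icc (0 : ℝ) 1) (k : Fin 2) :
    cantorStaircase r ((u + (k : ℕ) * (r - 1)) / r) = ((k : ℕ) + cantorStaircase r u) / 2 := by
  have hr0 : 0 < r := by linarith
  have hdigit : cantorDigit ((u + (k : ℕ) * (r - 1)) / r) = k := by
    obtain ⟨h0, h1⟩ := hu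
    simp only [cantorDigit, lt_div_iff₀ hr0]
    fin_cases k
    · simp
      linarith
    · simp
      linarith
  rw [cantorStaircase_eq, cantorShift, hdigit]
  congr 3
  field_simp
  ring

lemma IsCantorDust.abs_cantorStaircase_sub_le {r : ℝ} (hr : 2 < r)
    {C : Set (EuclideanSpace ℝ (Fin 2))} (hC : IsCantorDust r C) (i : Fin 2) (n : ℕ) :
    ∀ x ∈ C, ∀ y ∈ C, |x i - y i| < (r - 2) / r * r⁻¹ ^ n →
      |cantorStaircase r (x i) - cantorStaircase r (y i)| ≤ (1 / 2) ^ n := by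
  have hr0 : 0 < r := by linarith
  induction n with
  | zero =>
    intro x _ y _ _
    simpa [Real.dist_eq] using
      Real.dist_le_of_mem_Icc_01 (cantorStaircase_mem_Icc r (x i)) (cantorStaircase_mem_Icc r (y i))
  | succ n ih =>
    intro x hx y hy h
    obtain ⟨e, x, hx', rfl⟩ := hC.exists_eq_cantorSim hx
    obtain ⟨e', y, hy', rfl⟩ := hC.exists_eq_cantorSim hy
    have hxi := hC.apply_mem_Icc (by linarith) hx' i
    have hyi := hC.apply_mem_Icc (by linarith) hy' i
    simp only [cantorSim_apply] at h ⊢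
    have hgap : 0 < (r - 2) / r := div_pos (by linarith) hr0
    have hee : e i = e' i := by
      refine eq_of_dist_lt_gap hr hxi hyi (h.trans_le (mul_le_of_le_one_right hgap.le ?_))
      exact pow_le_one₀ (by positivity) (inv_le_one_of_one_le₀ (by linarith))
    rw [cantorStaircase_branch hr hxi, cantorStaircase_branch hr hyi, hee, ← sub_div,
      add_sub_add_left_eq_sub, abs_div, abs_two, pow_succ, ← div_eq_mul_one_div]
    gcongr
    apply ih x hx' y hy'
    rw [hee, ← sub_div, add_sub_add_right_eq_sub, abs_div, abs_of_pos hr0, div_lt_iff₀ hr0] at h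
    refine h.trans_eq ?_
    rw [pow_succ]
    field_simp

/-- The Cantor function applied to both coordinates. -/
noncomputable def cantorStaircaseMap (r : ℝ) (x : EuclideanSpace ℝ (Fin 2)) : Fin 2 → ℝ :=
  fun i => cantorStaircase r (x i)

lemma IsCantorDust.exists_holderOnWith {r : ℝ} (hr : 2 < r)
    {C : Set (EuclideanSpace ℝ (Fin 2))} (hC : IsCantorDust r C) :
    ∃ K, HolderOnWith K (Real.log 2 / Real.log r).toNNReal (cantorStaircaseMap r) C := by
  have hr0 : 0 < r := by linarith
  have hlogr : 0 < Real.log r := log_pos (by linarith)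
  set α := Real.log 2 / Real.log r with hα
  have hα0 : 0 < α := div_pos (log_pos one_lt_two) hlogr
  have hrα : r ^ α = 2 := by
    rw [rpow_def_of_pos hr0, hα, mul_div_cancel₀ _ hlogr.ne', Real.exp_log (by norm_num)]
  have hδ0 : 0 < (r - 2) / r / 2 := div_pos (div_pos (by linarith) hr0) two_pos
  set δ := (r - 2) / r / 2 with hδ
  have hbound : ∀ x ∈ C, ∀ y ∈ C, dist (cantorStaircaseMap r x) (cantorStaircaseMap r y) ≤
      2 * (δ⁻¹ ^ α) * dist x y ^ α := by
    intro x hx y hy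
    rw [dist_pi_le_iff (by positivity)]
    intro i
    rw [mul_assoc, ← mul_rpow (by positivity) dist_nonneg]
    rcases eq_or_ne x y with rfl | hxy
    · simp only [dist_self]
      positivity
    have hd : 0 < dist x y := dist_pos.2 hxy
    have hcoord : |x i - y i| ≤ dist x y := by
      rw [dist_eq_norm]
      exact PiLp.norm_apply_le (x - y) i
    rcases le_or_gt 1 (δ⁻¹ * dist x y) with h1 | h1
    · refine (Real.dist_le_of_mem_Icc_01 (cantorStaircase_mem_Icc r (x i))
        (cantorStaircase_mem_Icc r (y i))).trans ?_
      linarith [one_le_rpow h1 hα0.le]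
    · obtain ⟨n, hn, hn'⟩ := exists_nat_pow_near_of_lt_one (x := δ⁻¹ * dist x y) (y := r⁻¹)
        (by positivity) h1.le (by positivity) (inv_lt_one_of_one_lt₀ (by linarith))
      have hpow : 0 < r⁻¹ ^ n := by positivity
      have hlt : |x i - y i| < (r - 2) / r * r⁻¹ ^ n := by
        rw [inv_mul_le_iff₀ hδ0] at hn'
        have : (r - 2) / r * r⁻¹ ^ n = 2 * (δ * r⁻¹ ^ n) := by rw [hδ]; ring
        linarith [mul_pos hδ0 hpow]
      calc _ ≤ (1 / 2 : ℝ) ^ n := hC.abs_cantorStaircase_sub_le hr i n x hx y hy hlt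
        _ = 2 * (r⁻¹ ^ (n + 1)) ^ α := by
          rw [← rpow_natCast_mul (by positivity), mul_comm _ α, rpow_mul_natCast (by positivity),
            inv_rpow hr0.le, hrα]
          ring
        _ ≤ _ := by gcongr
  refine ⟨(2 * δ⁻¹ ^ α).toNNReal, fun x hx y hy => ?_⟩
  have h := hbound x hx y hy
  rw [edist_dist, edist_dist, coe_toNNReal _ hα0.le,
    ENNReal.ofReal_rpow_of_nonneg dist_nonneg hα0.le]
  refine (ENNReal.ofReal_le_ofReal h).trans_eq ?_
  rw [ENNReal.ofReal_mul (by positivity)]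
  rfl

/-- A nonempty compact set stable under the maps `z ↦ (z + e) / 2` with `e ∈ {0, 1} ^ ι`
contains the unit cube. -/
lemma Icc_subset_of_binary_branches {ι : Type*} [Fintype ι] {K : Set (ι → ℝ)} (hK : IsCompact K)
    (hne : K.Nonempty)
    (hstable : ∀ z ∈ K, ∀ e : ι → Fin 2, (fun i => (((e i : ℕ) : ℝ) + z i) / 2) ∈ K) :
    Icc 0 1 ⊆ K := by
  obtain ⟨z, hz, hmax⟩ := isCompact_Icc.exists_isMaxOn (s := Icc (0 : ι → ℝ) 1)
    (nonempty_Icc.2 zero_le_one) (continuous_infDist_pt K).continuousOn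
  obtain ⟨e, z', hz', heq⟩ : ∃ e : ι → Fin 2, ∃ z' ∈ Icc (0 : ι → ℝ) 1,
      ∀ i, z i = (((e i : ℕ) : ℝ) + z' i) / 2 := by
    refine ⟨fun i => if 1 / 2 < z i then 1 else 0,
      fun i => 2 * z i - (if 1 / 2 < z i then 1 else 0), ⟨fun i => ?_, fun i => ?_⟩, fun i => ?_⟩
    · have := hz.1 i
      simp only [Pi.zero_apply] at this ⊢
      split_ifs <;> linarith
    · have := hz.2 i
      simp only [Pi.one_apply] at this ⊢
      split_ifs <;> linarith
    · dsimp only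
      split_ifs <;> simp
  obtain ⟨w, hw, hdist⟩ := hK.exists_infDist_eq_dist hne z'
  have hhalf : infDist z K ≤ infDist z' K / 2 := by
    refine (infDist_le_dist_of_mem (hstable w hw e)).trans ?_
    rw [dist_pi_le_iff (div_nonneg infDist_nonneg zero_le_two)]
    intro i
    rw [heq i, Real.dist_eq, ← sub_div, add_sub_add_left_eq_sub, abs_div, abs_two, hdist]
    gcongr
    exact dist_le_pi_dist z' w i
  have hz'z : infDist z' K ≤ infDist z K := hmax hz'
  intro x hx
  have hxz : infDist x K ≤ infDist z K := hmax hx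
  rw [hK.isClosed.mem_iff_infDist_zero hne]
  linarith [infDist_nonneg (x := x) (s := K)]

lemma IsCantorDust.le_dimH {r : ℝ} (hr : 2 < r) {C : Set (EuclideanSpace ℝ (Fin 2))}
    (hC : IsCantorDust r C) : ENNReal.ofReal (Real.log 4 / Real.log r) ≤ dimH C := by
  have hlogr : 0 < Real.log r := log_pos (by linarith)
  have hα0 : 0 < (Real.log 2 / Real.log r).toNNReal :=
    toNNReal_pos.2 (div_pos (log_pos one_lt_two) hlogr)
  obtain ⟨K, hK⟩ := hC.exists_holderOnWith hr
  have hcube : Icc 0 1 ⊆ cantorStaircaseMap r '' C := by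
    refine Icc_subset_of_binary_branches (hC.1.image_of_continuousOn (hK.continuousOn hα0))
      (hC.2.1.image _) ?_
    rintro _ ⟨x, hx, rfl⟩ e
    refine ⟨cantorSim r e x, hC.cantorSim_mem e hx, ?_⟩
    ext i
    rw [cantorStaircaseMap, cantorSim_apply,
      cantorStaircase_branch hr (hC.apply_mem_Icc (by linarith) hx i), cantorStaircaseMap]
  have hdim : dimH (Icc (0 : Fin 2 → ℝ) 1) = 2 := by
    rw [Real.dimH_of_nonempty_interior]
    · simp
    · rw [← pi_univ_Icc, interior_pi_set finite_univ]
      simp only [interior_Icc]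
      exact univ_pi_nonempty_iff.2 fun i => nonempty_Ioo.2 (by simp)
  have h := (hdim.symm.trans_le (dimH_mono hcube)).trans (hK.dimH_image_le hα0)
  rw [ENNReal.le_div_iff_mul_le (Or.inl (by simpa using hα0.ne')) (Or.inl ENNReal.coe_ne_top)] at h
  refine le_trans (le_of_eq ?_) h
  have hlog4 : Real.log 4 = 2 * Real.log 2 := by
    rw [← Real.log_rpow two_pos]
    norm_num
  rw [hlog4, mul_div_assoc, ENNReal.ofReal_mul zero_le_two, ENNReal.ofReal_ofNat, ENNReal.ofReal]

/-- For `r > 2` the Minkowski dimension of `C^r` exists and equals `D_r = log 4 / log r`,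
i.e. `lim_{ε→0⁺} log λ²((C^r)_ε) / log ε = 2 - log 4 / log r`; moreover the Hausdorff
dimension of `C^r` also equals `log 4 / log r`. -/
theorem stmt_14 (r : ℝ) (hr : 2 < r) (C : Set (EuclideanSpace ℝ (Fin 2)))
    (hC : IsCantorDust r C) :
    Filter.Tendsto
      (fun ε : ℝ => Real.log (volume (cthickening ε C)).toReal / Real.log ε)
      (𝓝[>] 0) (𝓝 (2 - Real.log 4 / Real.log r)) ∧
    dimH C = ENNReal.ofReal (Real.log 4 / Real.log r) :=
  ⟨hC.tendsto_log_volume_cthickening hr, (hC.dimH_le (by linarith)).antisymm (hC.le_dimH hr)⟩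
end
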